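/- Let G be a graph with exactly one end, and suppose this end has finite vertex degree. Then the automorphism group Aut(G) is either finite or has at least 2^{ℵ₀} elements. -/

import Mathlib

open Set Cardinal

namespace PaperEnds

/-- A ray in `G`: a one-sided infinite path, i.e. an injective sequence of
pairwise adjacent consecutive vertices. -/
def IsRay {V : Type} (G : SimpleGraph V) (r : ℕ → V) : Prop :=
  Function.Injective r ∧ ∀ n, G.Adj (r n) (r (n + 1))

/-- `a` and `b` are connected by a walk avoiding the vertex set `S`. -/
def ReachableOutside {V : Type} (G : SimpleGraph V) (S : Set V) (a b : V) : Prop :=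
  ∃ w : G.Walk a b, ∀ v ∈ w.support, v ∉ S

/-- Two rays are equivalent (belong to the same end) if for every finite vertex
set `S` they have tails lying in the same component of `G − S`. -/
def RayEquiv {V : Type} (G : SimpleGraph V) (r₁ r₂ : ℕ → V) : Prop :=
  ∀ S : Set V, S.Finite → ∃ m n : ℕ,
    (∀ i, m ≤ i → r₁ i ∉ S) ∧ (∀ j, n ≤ j → r₂ j ∉ S) ∧
    ReachableOutside G S (r₁ m) (r₂ n)

/-- `r` is a ray belonging to the end represented by the ray `ω`. -/
def InEnd {V : Type} (G : SimpleGraph V) (ω r : ℕ → V) : Prop :=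
  IsRay G r ∧ RayEquiv G r ω

/-- `G` has exactly one end: it has a ray and any two rays are equivalent. -/
def OneEnded {V : Type} (G : SimpleGraph V) : Prop :=
  (∃ r, IsRay G r) ∧ ∀ r₁ r₂, IsRay G r₁ → IsRay G r₂ → RayEquiv G r₁ r₂

/-- A family of pairwise (vertex-)disjoint rays. -/
def DisjointRays {V : Type} {ι : Type} (f : ι → ℕ → V) : Prop :=
  Pairwise fun i j => Disjoint (Set.range (f i)) (Set.range (f j))

/-- The end represented by `ω` has vertex degree `k`: the maximum cardinality of a
family of pairwise disjoint rays belonging to the end is `k`. -/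
def EndVertexDegree {V : Type} (G : SimpleGraph V) (ω : ℕ → V) (k : ℕ) : Prop :=
  (∃ f : Fin k → ℕ → V, (∀ i, InEnd G ω (f i)) ∧ DisjointRays f) ∧
  ¬ ∃ f : Fin (k + 1) → ℕ → V, (∀ i, InEnd G ω (f i)) ∧ DisjointRays f

/-- `v` dominates the end represented by `ω`: for every ray `r` in the end there are
infinitely many `v`–`r` paths pairwise meeting only in `v`. -/
def Dominates {V : Type} (G : SimpleGraph V) (v : V) (ω : ℕ → V) : Prop :=
  ∀ r : ℕ → V, InEnd G ω r →
    ∃ (t : ℕ → ℕ) (P : (n : ℕ) → G.Walk v (r (t n))),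
      Function.Injective t ∧
      (∀ n, (P n).IsPath) ∧
      (∀ n, ∀ u ∈ (P n).support, u ∈ Set.range r → u = r (t n)) ∧
      (∀ m n, m ≠ n → ∀ u, u ∈ (P m).support → u ∈ (P n).support → u = v)

/-- The end represented by `ω` is undominated. -/
def Undominated {V : Type} (G : SimpleGraph V) (ω : ℕ → V) : Prop :=
  ¬ ∃ v, Dominates G v ω

/-- `(A, B)` is a separation of `G`. -/
def IsSeparation {V : Type} (G : SimpleGraph V) (A B : Set V) : Prop :=
  A ∪ B = Set.univ ∧ ∀ a ∈ A \ B, ∀ b ∈ B \ A, ¬ G.Adj a b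

/-- The order of a separation `(A, B)`, i.e. `|A ∩ B|` as an extended natural number. -/
noncomputable def SepOrder {V : Type} (A B : Set V) : ℕ∞ := (A ∩ B).encard

/-- The end represented by `ω` lies in the side `B`: every ray of the end has all
but finitely many vertices in `B`. -/
def LiesIn {V : Type} (G : SimpleGraph V) (ω : ℕ → V) (B : Set V) : Prop :=
  ∀ r, InEnd G ω r → ∃ m, ∀ n, m ≤ n → r n ∈ B

/-- The vertex set `s` is connected in `G` (any two of its vertices are joined by a
walk inside `s`). -/
def ConnectedIn {V : Type} (G : SimpleGraph V) (s : Set V) : Prop :=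
  ∀ a ∈ s, ∀ b ∈ s, ∃ w : G.Walk a b, ∀ v ∈ w.support, v ∈ s

/-- `(A, B)` is an ω-relevant separation (for the end of vertex degree `k`
represented by the ray `ω`). -/
def Relevant {V : Type} (G : SimpleGraph V) (ω : ℕ → V) (k : ℕ) (A B : Set V) : Prop :=
  IsSeparation G A B ∧ SepOrder A B = (k : ℕ∞) ∧
  ConnectedIn G (A \ B) ∧
  (∀ v ∈ A ∩ B, ∃ u ∈ A \ B, G.Adj v u) ∧
  LiesIn G ω B ∧
  ¬ ∃ C D : Set V, IsSeparation G C D ∧ SepOrder C D < (k : ℕ∞) ∧ A ⊆ C ∧ LiesIn G ω D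

/-- Two separations `(A, B)` and `(C, D)` are nested. -/
def Nested {V : Type} (A B C D : Set V) : Prop :=
  (A ⊆ C ∧ D ⊆ B) ∨ (A ⊆ D ∧ C ⊆ B) ∨ (B ⊆ C ∧ D ⊆ A) ∨ (B ⊆ D ∧ C ⊆ A)

section P1
open scoped Pointwise
variable {V : Type} {G : SimpleGraph V} {ω : ℕ → V}

/-- Reachability outside a set. -/
def RO {V : Type} (G : SimpleGraph V) (L : Set V) (a b : V) : Prop := ReachableOutside G L a b

theorem RO.refl {L : Set V} {a : V} (h : a ∉ L) : RO G L a a :=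
  ⟨SimpleGraph.Walk.nil, by simpa using h⟩

theorem RO.symm {L : Set V} {a b : V} (h : RO G L a b) : RO G L b a := by
  obtain ⟨w, hw⟩ := h
  exact ⟨w.reverse, by simpa using hw⟩

theorem RO.trans {L : Set V} {a b c : V} (h : RO G L a b) (h' : RO G L b c) : RO G L a c := by
  obtain ⟨w, hw⟩ := h
  obtain ⟨w', hw'⟩ := h'
  refine ⟨w.append w', fun v hv => ?_⟩
  rw [SimpleGraph.Walk.mem_support_append_iff] at hv
  exact hv.elim (hw v) (hw' v)

theorem RO.mono {L L' : Set V} {a b : V} (hL : L ⊆ L') (h : RO G L' a b) : RO G L a b := by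
  obtain ⟨w, hw⟩ := h
  exact ⟨w, fun v hv h' => hw v hv (hL h')⟩

theorem RO.left {L : Set V} {a b : V} (h : RO G L a b) : a ∉ L := by
  obtain ⟨w, hw⟩ := h
  exact hw a w.start_mem_support

theorem RO.right {L : Set V} {a b : V} (h : RO G L a b) : b ∉ L := h.symm.left

theorem RO.adj {L : Set V} {a b : V} (h : G.Adj a b) (ha : a ∉ L) (hb : b ∉ L) :
    RO G L a b := by
  refine ⟨h.toWalk, fun v hv => ?_⟩
  simp at hv
  rcases hv with rfl | rfl <;> assumption

theorem RO.step {L : Set V} {a b c : V} (h : RO G L a b) (h' : G.Adj b c) (hc : c ∉ L) :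
    RO G L a c := h.trans (RO.adj h' h.right hc)

theorem RO.induct {L K : Set V} (hK : ∀ u v, u ∈ K → u ∉ L → G.Adj u v → v ∉ L → v ∈ K)
    {a b : V} (ha : a ∈ K) (h : RO G L a b) : b ∈ K := by
  obtain ⟨w, hw⟩ := h
  induction w with
  | nil => exact ha
  | cons hadj p ih =>
    refine ih (hK _ _ ha (hw _ (by simp)) hadj (hw _ (by simp))) (fun v hv => hw v (by simp [hv]))

theorem RO.change {L L' : Set V} {a b : V} (h : RO G L a b) (h' : ∀ c, RO G L a c → c ∉ L') :
    RO G L' a b := by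
  have : b ∈ {v | RO G L a v ∧ RO G L' a v} := by
    refine RO.induct (K := {v | RO G L a v ∧ RO G L' a v}) ?_ ⟨.refl h.left, .refl (h' a (.refl h.left))⟩ h
    rintro u v ⟨h1, h2⟩ _ h4 h5
    exact ⟨h1.step h4 h5, h2.step h4 (h' _ (h1.step h4 h5))⟩
  exact this.2

theorem adj_smul (g : G ≃g G) {a b : V} : G.Adj (g • a) (g • b) ↔ G.Adj a b := g.map_rel_iff

theorem RO.smul (g : G ≃g G) {L : Set V} {a b : V} (h : RO G L a b) :
    RO G (g • L) (g • a) (g • b) := by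
  have ha := h.left
  refine RO.induct (K := {v | RO G (g • L) (g • a) (g • v)}) ?_ ?_ h
  · intro u v hu _ huv hv
    exact RO.step hu ((adj_smul g).2 huv) (by rwa [Set.smul_mem_smul_set_iff])
  · exact RO.refl (by rwa [Set.smul_mem_smul_set_iff])

theorem RO.smul_iff (g : G ≃g G) {L : Set V} {a b : V} :
    RO G (g • L) (g • a) (g • b) ↔ RO G L a b :=
  ⟨fun h => by simpa using h.smul g⁻¹, fun h => h.smul g⟩

theorem RO.firstStep {L : Set V} {a b : V} (h : RO G L a b) (hne : b ≠ a) :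
    ∃ b', G.Adj a b' ∧ RO G (L ∪ {a}) b' b := by
  have : b ∈ {b | b = a ∨ ∃ b', G.Adj a b' ∧ RO G (L ∪ {a}) b' b} := by
    refine RO.induct ?_ (Or.inl rfl) h
    rintro u v hu huL huv hv
    by_cases hva : v = a
    · exact Or.inl hva
    right
    have hv' : v ∉ L ∪ {a} := by simp [hv, hva]
    rcases hu with rfl | ⟨b', h1, h2⟩
    · exact ⟨v, huv, .refl hv'⟩
    · exact ⟨b', h1, h2.step huv hv'⟩
  exact this.resolve_left hne

/-- The component of `a` in `G - L`. -/
def cmp {V : Type} (G : SimpleGraph V) (L : Set V) (a : V) : Set V := {b | RO G L a b}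

theorem mem_cmp {L : Set V} {a b : V} : b ∈ cmp G L a ↔ RO G L a b := Iff.rfl

theorem cmp_eq {L : Set V} {a b : V} (h : RO G L a b) : cmp G L a = cmp G L b := by
  ext c
  exact ⟨fun h' => h.symm.trans h', fun h' => h.trans h'⟩

theorem cmp_smul (g : G ≃g G) {L : Set V} {a : V} : g • cmp G L a = cmp G (g • L) (g • a) := by
  ext v
  rw [Set.mem_smul_set_iff_inv_smul_mem, mem_cmp, mem_cmp, ← RO.smul_iff g, smul_inv_smul]

theorem cmp_disj {L : Set V} {a : V} : Disjoint (cmp G L a) L := by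
  rw [Set.disjoint_left]
  exact fun v hv => RO.right hv

/-- The one-ended hypothesis. -/
structure OE {V : Type} (G : SimpleGraph V) (ω : ℕ → V) : Prop where
  ray : IsRay G ω
  one : ∀ r, IsRay G r → RayEquiv G r ω

/-- The component of `G - X` containing the end. -/
def C {V : Type} (G : SimpleGraph V) (ω : ℕ → V) (X : Set V) : Set V :=
  {v | ∃ n, (∀ i, n ≤ i → ω i ∉ X) ∧ RO G X v (ω n)}

theorem OE.tail (h : OE G ω) {X : Set V} (hX : X.Finite) : ∃ n, ∀ i, n ≤ i → ω i ∉ X := by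
  have : (ω ⁻¹' X).Finite := hX.preimage h.ray.1.injOn
  obtain ⟨n, hn⟩ := this.bddAbove
  exact ⟨n + 1, fun i hi hiX => by have := hn hiX; omega⟩

theorem tail_conn {r : ℕ → V} (h : IsRay G r) {X : Set V} {n : ℕ} (hn : ∀ i, n ≤ i → r i ∉ X)
    {j : ℕ} (hj : n ≤ j) : RO G X (r n) (r j) := by
  induction j, hj using Nat.le_induction with
  | base => exact .refl (hn _ le_rfl)
  | succ j hj ih => exact ih.step (h.2 j) (hn _ (by omega))

theorem OE.mem_C (_h : OE G ω) {X : Set V} {n : ℕ} (hn : ∀ i, n ≤ i → ω i ∉ X) : ω n ∈ C G ω X :=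
  ⟨n, hn, .refl (hn _ le_rfl)⟩

theorem OE.C_nonempty (h : OE G ω) {X : Set V} (hX : X.Finite) : (C G ω X).Nonempty := by
  obtain ⟨n, hn⟩ := h.tail hX
  exact ⟨_, h.mem_C hn⟩

theorem C_closed {X : Set V} {v w : V} (hv : v ∈ C G ω X) (h : RO G X v w) : w ∈ C G ω X := by
  obtain ⟨n, hn, h'⟩ := hv
  exact ⟨n, hn, h.symm.trans h'⟩

theorem OE.C_conn (h : OE G ω) {X : Set V} {v w : V} (hv : v ∈ C G ω X) (hw : w ∈ C G ω X) :
    RO G X v w := by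
  obtain ⟨n, hn, h1⟩ := hv
  obtain ⟨m, hm, h2⟩ := hw
  exact (h1.trans (tail_conn h.ray hn (le_max_left n m))).trans
    (h2.trans (tail_conn h.ray hm (le_max_right n m))).symm

theorem OE.C_eq_cmp (h : OE G ω) {X : Set V} {v : V} (hv : v ∈ C G ω X) : C G ω X = cmp G X v :=
  Set.Subset.antisymm (fun _ hw => h.C_conn hv hw) (fun _ hw => C_closed hv hw)

theorem C_anti {X Y : Set V} (h : X ⊆ Y) : C G ω Y ⊆ C G ω X := by
  rintro v ⟨n, hn, hv⟩
  exact ⟨n, fun i hi h' => hn i hi (h h'), hv.mono h⟩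

theorem C_disj {X : Set V} : Disjoint (C G ω X) X := by
  rw [Set.disjoint_left]
  rintro v ⟨n, hn, hv⟩
  exact hv.left

theorem OE.C_sub (h : OE G ω) {X Y : Set V} (hX : X.Finite) (hY : Y.Finite)
    (hd : Disjoint Y (C G ω X)) : C G ω X ⊆ C G ω Y := by
  intro v hv
  obtain ⟨n, hn⟩ := h.tail (hX.union hY)
  have h1 : ω n ∈ C G ω X := h.mem_C (fun i hi h' => hn i hi (Or.inl h'))
  have h2 := h.C_conn hv h1
  refine ⟨n, fun i hi h' => hn i hi (Or.inr h'), h2.change fun c hc hcY => ?_⟩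
  exact Set.disjoint_left.1 hd hcY (C_closed hv hc)

theorem OE.C_smul_sub (h : OE G ω) (g : G ≃g G) (X : Set V) (hX : X.Finite) :
    g • C G ω X ⊆ C G ω (g • X) := by
  rintro _ ⟨v, ⟨n, hn, hv⟩, rfl⟩
  have hr : IsRay G (fun i => g • ω i) :=
    ⟨fun i j hij => h.ray.1 (smul_left_cancel g hij), fun i => (adj_smul g).2 (h.ray.2 i)⟩
  obtain ⟨m, n', h1, h2, h3⟩ := h.one _ hr (g • X) (hX.image _)
  refine ⟨n', h2, ?_⟩
  have hn' : ∀ i, n ≤ i → (fun i => g • ω i) i ∉ g • X := by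
    intro i hi
    exact fun h' => hn i hi (Set.smul_mem_smul_set_iff.1 h')
  exact ((hv.smul g).trans (tail_conn hr hn' (le_max_left n m))).trans
    ((tail_conn hr h1 (le_max_right n m)).symm.trans h3)

theorem OE.C_smul (h : OE G ω) (g : G ≃g G) (X : Set V) (hX : X.Finite) :
    g • C G ω X = C G ω (g • X) := by
  refine (h.C_smul_sub g X hX).antisymm ?_
  have := h.C_smul_sub g⁻¹ (g • X) (hX.image _)
  rw [inv_smul_smul, Set.smul_set_subset_iff_subset_inv_smul_set, inv_inv] at this
  exact this

/-- Sets avoided by the end. -/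
def Small {V : Type} (G : SimpleGraph V) (ω : ℕ → V) (A : Set V) : Prop :=
  ∃ X : Set V, X.Finite ∧ Disjoint (C G ω X) A

theorem Small.mono {A B : Set V} (hB : Small G ω B) (h : A ⊆ B) : Small G ω A := by
  obtain ⟨X, hX, hd⟩ := hB
  exact ⟨X, hX, hd.mono_right h⟩

theorem Small.union {A B : Set V} (hA : Small G ω A) (hB : Small G ω B) : Small G ω (A ∪ B) := by
  obtain ⟨X, hX, hd⟩ := hA
  obtain ⟨Y, hY, hd'⟩ := hB
  refine ⟨X ∪ Y, hX.union hY, ?_⟩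
  rw [Set.disjoint_union_right]
  exact ⟨hd.mono_left (C_anti Set.subset_union_left), hd'.mono_left (C_anti Set.subset_union_right)⟩

theorem small_finite {A : Set V} (h : A.Finite) : Small G ω A := ⟨A, h, C_disj⟩

theorem small_biUnion {ι : Type*} {s : Set ι} (hs : s.Finite) {A : ι → Set V}
    (h : ∀ i ∈ s, Small G ω (A i)) : Small G ω (⋃ i ∈ s, A i) := by
  induction s, hs using Set.Finite.induction_on with
  | empty => simpa using small_finite Set.finite_empty
  | insert _ _ ih =>
    rw [Set.biUnion_insert]
    exact (h _ (by simp)).union (ih fun i hi => h i (by simp [hi]))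

theorem OE.not_small (h : OE G ω) {X A : Set V} (hX : X.Finite) (hA : C G ω X ⊆ A) :
    ¬ Small G ω A := by
  rintro ⟨Y, hY, hd⟩
  obtain ⟨v, hv⟩ := h.C_nonempty (hX.union hY)
  exact Set.disjoint_left.1 hd (C_anti Set.subset_union_right hv) (hA (C_anti Set.subset_union_left hv))

theorem OE.small_compl_C (_h : OE G ω) {X : Set V} (hX : X.Finite) : Small G ω (C G ω X)ᶜ :=
  ⟨X, hX, disjoint_compl_right⟩

theorem OE.small_smul (h : OE G ω) (g : G ≃g G) {A : Set V} (hA : Small G ω A) :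
    Small G ω (g • A) := by
  obtain ⟨X, hX, hd⟩ := hA
  refine ⟨g • X, hX.image _, ?_⟩
  rw [← h.C_smul g X hX]
  simpa using hd

/-- Inner vertex boundary. -/
def bd {V : Type} (G : SimpleGraph V) (A : Set V) : Set V := {v | v ∈ A ∧ ∃ w, w ∉ A ∧ G.Adj v w}

theorem bd_sub {A : Set V} : bd G A ⊆ A := fun _ h => h.1

theorem bd_smul (g : G ≃g G) (A : Set V) : bd G (g • A) = g • bd G A := by
  ext v
  rw [Set.mem_smul_set_iff_inv_smul_mem]
  constructor
  · rintro ⟨h1, w, hw, h2⟩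
    refine ⟨Set.mem_smul_set_iff_inv_smul_mem.1 h1, g⁻¹ • w, ?_, (adj_smul g⁻¹).2 h2⟩
    rwa [← Set.mem_smul_set_iff_inv_smul_mem]
  · rintro ⟨h1, w, hw, h2⟩
    refine ⟨Set.mem_smul_set_iff_inv_smul_mem.2 h1, g • w, ?_, ?_⟩
    · rwa [Set.smul_mem_smul_set_iff]
    · have := (adj_smul g).2 h2
      rwa [smul_inv_smul] at this

theorem OE.dich (h : OE G ω) (U : Set V) :
    C G ω (bd G U) ⊆ U ∨ Disjoint (C G ω (bd G U)) U := by
  by_cases hd : Disjoint (C G ω (bd G U)) U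
  · exact Or.inr hd
  left
  obtain ⟨x, hx, hxU⟩ := Set.not_disjoint_iff.1 hd
  intro y hy
  refine RO.induct ?_ hxU (h.C_conn hx hy)
  intro u v hu hub huv _
  by_contra hv
  exact hub ⟨hu, v, hv, huv⟩

theorem OE.dich_small (h : OE G ω) {U : Set V} (hU : Small G ω U) (hf : (bd G U).Finite) :
    Disjoint (C G ω (bd G U)) U :=
  (h.dich U).resolve_left fun h' => h.not_small hf h' hU

theorem encard_submod {P Q R S : Set V} (h1 : P ∪ Q ⊆ R ∪ S) (h2 : P ∩ Q ⊆ R ∩ S) :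
    P.encard + Q.encard ≤ R.encard + S.encard := by
  rw [← Set.encard_union_add_encard_inter P Q, ← Set.encard_union_add_encard_inter R S]
  exact add_le_add (Set.encard_le_encard h1) (Set.encard_le_encard h2)

theorem bd_union_inter_sub {A B : Set V} : bd G (A ∪ B) ∪ bd G (A ∩ B) ⊆ bd G A ∪ bd G B := by
  rintro v (⟨h1 | h1, w, hw, h2⟩ | ⟨h1, w, hw, h2⟩)
  · exact Or.inl ⟨h1, w, fun h => hw (Or.inl h), h2⟩
  · exact Or.inr ⟨h1, w, fun h => hw (Or.inr h), h2⟩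
  · by_cases hA : w ∈ A
    · exact Or.inr ⟨h1.2, w, fun h => hw ⟨hA, h⟩, h2⟩
    · exact Or.inl ⟨h1.1, w, hA, h2⟩

theorem bd_union_sub {A B : Set V} : bd G (A ∪ B) ⊆ bd G A ∪ bd G B :=
  Set.subset_union_left.trans bd_union_inter_sub

theorem bd_inter_sub {A B : Set V} : bd G (A ∩ B) ⊆ bd G A ∪ bd G B :=
  Set.subset_union_right.trans bd_union_inter_sub

theorem bd_union_inter_sub2 {A B : Set V} : bd G (A ∪ B) ∩ bd G (A ∩ B) ⊆ bd G A ∩ bd G B := by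
  rintro v ⟨⟨_, w, hw, h⟩, h1, _⟩
  exact ⟨⟨h1.1, w, fun h => hw (Or.inl h), h⟩, ⟨h1.2, w, fun h => hw (Or.inr h), h⟩⟩

theorem bd_submod (A B D : Set V) :
    (bd G (A ∪ B) \ D).encard + (bd G (A ∩ B) \ D).encard ≤
      (bd G A \ D).encard + (bd G B \ D).encard := by
  apply encard_submod
  · rw [← Set.union_sdiff_distrib, ← Set.union_sdiff_distrib]
    exact Set.sdiff_subset_sdiff_left bd_union_inter_sub
  · rintro v ⟨⟨h1, h2⟩, h3, _⟩
    have := bd_union_inter_sub2 (G := G) ⟨h1, h3⟩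
    exact ⟨⟨this.1, h2⟩, this.2, h2⟩

theorem bd_submod_strict {A B : Set V} (hA : (bd G A).Finite) (hB : (bd G B).Finite)
    {v : V} (h1 : v ∈ bd G A) (h2 : v ∉ B) (h3 : v ∉ bd G (A ∪ B)) :
    (bd G (A ∪ B)).encard + (bd G (A ∩ B)).encard < (bd G A).encard + (bd G B).encard := by
  rw [← Set.encard_union_add_encard_inter (bd G (A ∪ B)), ← Set.encard_union_add_encard_inter (bd G A)]
  have hlt : (bd G (A ∪ B) ∪ bd G (A ∩ B)).encard < (bd G A ∪ bd G B).encard := by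
    apply Set.Finite.encard_lt_encard ((hA.union hB).subset bd_union_inter_sub)
    refine ⟨bd_union_inter_sub, fun h => ?_⟩
    rcases h (Or.inl h1) with h | h
    · exact h3 h
    · exact h2 h.1.2
  refine ENat.add_lt_add_of_lt_of_le ?_ hlt (Set.encard_le_encard bd_union_inter_sub2)
  exact ((hA.subset (bd_union_inter_sub2.trans Set.inter_subset_left)).encard_lt_top).ne

theorem enat_aux {a b : ℕ∞} {c d : ℕ} (h : a + b ≤ c + d) (hb : (c : ℕ∞) ≤ b) : a ≤ d := by
  have : (c : ℕ∞) + a ≤ c + d := by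
    rw [add_comm]; exact (add_le_add le_rfl hb).trans h
  exact (ENat.add_le_add_iff_left (ENat.natCast_ne_top c)).1 this

theorem finite_sub_directed {𝒢 : Set (Set V)} (hne : 𝒢.Nonempty)
    (hd : ∀ A ∈ 𝒢, ∀ B ∈ 𝒢, ∃ D ∈ 𝒢, A ⊆ D ∧ B ⊆ D) {t : Set V} (ht : t.Finite)
    (hsub : t ⊆ ⋃₀ 𝒢) : ∃ A ∈ 𝒢, t ⊆ A := by
  induction t, ht using Set.Finite.induction_on with
  | empty => exact ⟨hne.some, hne.some_mem, by simp⟩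
  | insert _ _ ih =>
    rw [Set.insert_subset_iff] at hsub
    obtain ⟨A, hA, h1⟩ := ih hsub.2
    obtain ⟨B, hB, h2⟩ := hsub.1
    obtain ⟨D, hD, h3, h4⟩ := hd A hA B hB
    exact ⟨D, hD, Set.insert_subset (h4 h2) (h1.trans h3)⟩

theorem bd_sUnion_le {𝒢 : Set (Set V)} (hne : 𝒢.Nonempty)
    (hd : ∀ A ∈ 𝒢, ∀ B ∈ 𝒢, ∃ D ∈ 𝒢, A ⊆ D ∧ B ⊆ D) {D : Set V} {n : ℕ}
    (hb : ∀ A ∈ 𝒢, (bd G A \ D).encard ≤ n) : (bd G (⋃₀ 𝒢) \ D).encard ≤ n := by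
  by_contra hlt
  have hlt : ((n + 1 : ℕ) : ℕ∞) ≤ (bd G (⋃₀ 𝒢) \ D).encard := by
    push_cast; exact Order.add_one_le_of_lt (not_le.1 hlt)
  obtain ⟨t, ht, hcard⟩ := Set.exists_subset_encard_eq hlt
  have htf : t.Finite := Set.finite_of_encard_eq_coe hcard
  obtain ⟨A, hA, hsub⟩ := finite_sub_directed hne hd htf (fun v hv => (ht hv).1.1)
  have : t ⊆ bd G A \ D := by
    intro v hv
    obtain ⟨⟨_, w, hw, h2⟩, h3⟩ := ht hv
    exact ⟨⟨hsub hv, w, fun h => hw ⟨A, hA, h⟩, h2⟩, h3⟩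
  have := (Set.encard_le_encard this).trans (hb A hA)
  rw [hcard] at this
  have := Nat.cast_le.1 this
  omega

/-- Auxiliary well-founded rank predicate on components. -/
inductive Tm {V : Type} (G : SimpleGraph V) : Set V → V → Prop
  | mk (L : Set V) (a : V) (S : Set V) : S.Finite → L ⊆ S →
      (∀ b, RO G L a b → b ∉ S → Tm G S b) → Tm G L a

theorem Tm.congr {L : Set V} {a b : V} (h : Tm G L a) (hab : RO G L a b) : Tm G L b := by
  cases h with
  | mk _ _ S hS hL h => exact .mk L b S hS hL fun c hc hcS => h c (hab.trans hc) hcS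

theorem OE.tm (h : OE G ω) {L : Set V} (hL : L.Finite) {a : V} (ha : a ∉ C G ω L) : Tm G L a := by
  by_contra hT
  have haL : a ∉ L := fun haL => hT (.mk L a L hL subset_rfl fun b hb _ => (hb.left haL).elim)
  let St := {p : Set V × V // p.1.Finite ∧ p.2 ∉ p.1 ∧ ¬ Tm G p.1 p.2}
  have step : ∀ p : St, ∃ q : St, q.1.1 = p.1.1 ∪ {p.1.2} ∧ G.Adj p.1.2 q.1.2 := by
    rintro ⟨⟨L, a⟩, hL, haL, hT⟩
    simp only at hL haL hT
    by_contra hq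
    apply hT
    refine .mk L a (L ∪ {a}) (hL.union (Set.finite_singleton a)) Set.subset_union_left ?_
    intro b hb hbS
    by_contra hTb
    obtain ⟨b', h1, h2⟩ := hb.firstStep (fun h => hbS (by simp [h]))
    exact hq ⟨⟨⟨L ∪ {a}, b'⟩, hL.union (Set.finite_singleton a), h2.left,
      fun h => hTb (h.congr h2)⟩, rfl, h1⟩
  choose nx hnx1 hnx2 using step
  let s : ℕ → St := fun n => nx^[n] ⟨⟨L, a⟩, hL, haL, hT⟩
  have hs : ∀ n, s (n + 1) = nx (s n) := fun n => Function.iterate_succ_apply' _ _ _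
  have hmem : ∀ n j, n < j → (s n).1.2 ∈ (s j).1.1 := by
    intro n j hnj
    induction j, hnj using Nat.le_induction with
    | base => rw [hs, hnx1]; simp
    | succ j _ ih => rw [hs, hnx1]; exact Or.inl ih
  have hLs : ∀ n, L ⊆ (s n).1.1 := by
    intro n
    induction n with
    | zero => exact subset_rfl
    | succ n ih => rw [hs, hnx1]; exact ih.trans Set.subset_union_left
  have hr : IsRay G (fun n => (s n).1.2) := by
    refine ⟨?_, fun n => ?_⟩
    · intro i j hij
      by_contra hne
      simp only at hij
      rcases lt_or_gt_of_ne hne with hlt | hlt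
      · exact (s j).2.2.1 (hij ▸ hmem i j hlt)
      · exact (s i).2.2.1 (hij ▸ hmem j i hlt)
    · simp only [hs]; exact hnx2 _
  obtain ⟨m, n, h1, h2, h3⟩ := h.one _ hr L hL
  have : RO G L (s 0).1.2 (s m).1.2 :=
    tail_conn hr (n := 0) (fun i _ hi => (s i).2.2.1 (hLs i hi)) (Nat.zero_le m)
  exact ha ⟨n, h2, this.trans h3⟩

theorem OE.small_induction (h : OE G ω) {Pr : Set V → Prop}
    (step : ∀ S : Set V, S.Finite → ∀ B : Set V, (∀ b ∈ B, b ∉ S → Pr (cmp G S b)) → Pr B)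
    {A : Set V} (hA : Small G ω A) : Pr A := by
  have key : ∀ L a, Tm G L a → Pr (cmp G L a) := by
    intro L a hT
    induction hT with
    | mk L a S hS hL _ ih => exact step S hS _ fun b hb hbS => ih b hb hbS
  obtain ⟨X, hX, hd⟩ := hA
  exact step X hX A fun b hb _ => key X b (h.tm hX (Set.disjoint_right.1 hd hb))

end P1


section P2
variable {V : Type} {G : SimpleGraph V} {ω : ℕ → V}

/-- Every finite set lies in a small set with boundary of size at most `κ`. -/
def Bdd {V : Type} (G : SimpleGraph V) (ω : ℕ → V) (κ : ℕ) : Prop :=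
  ∀ Z : Set V, Z.Finite → ∃ A, Small G ω A ∧ Z ⊆ A ∧ (bd G A).encard ≤ κ

/-- Linkedness state used to build disjoint rays. -/
structure Good {V : Type} (G : SimpleGraph V) (ω : ℕ → V) {m : ℕ} (F : Set V) (e : Fin m → V) :
    Prop where
  fin : F.Finite
  inj : Function.Injective e
  disj : ∀ j, e j ∉ F
  link : ∀ A, Small G ω A → F ⊆ A → Set.range e ⊆ A → (m : ℕ∞) ≤ (bd G A \ F).encard

theorem exists_inj_of_encard {s : Set V} {m : ℕ} (v : V) (h : (m : ℕ∞) ≤ s.encard) :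
    ∃ e : Fin m → V, Function.Injective e ∧ Set.range e ⊆ s := by
  have : Nonempty V := ⟨v⟩
  obtain ⟨f, h1, h2⟩ := (Set.finite_univ (α := Fin m)).exists_injOn_of_encard_le (t := s)
    (by simpa using h)
  refine ⟨f, Set.injOn_univ.1 h2, ?_⟩
  rintro _ ⟨i, rfl⟩
  exact h1 (Set.mem_univ i)

theorem good_init {m : ℕ} (hm : ¬ Bdd G ω m) : ∃ e : Fin m → V, Good G ω ∅ e := by
  unfold Bdd at hm
  push Not at hm
  obtain ⟨Z, hZ, hlt⟩ := hm
  obtain ⟨A₀, ⟨hA₀, hZA₀⟩, hmin⟩ := exists_minimalFor_of_wellFoundedLT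
    (fun A : Set V => Small G ω A ∧ Z ⊆ A) (fun A => (bd G A).encard)
    ⟨Z, small_finite hZ, subset_rfl⟩
  have hmin : ∀ B, Small G ω B → Z ⊆ B → (bd G A₀).encard ≤ (bd G B).encard := by
    intro B hB hZB
    rcases le_total (bd G A₀).encard (bd G B).encard with h | h
    · exact h
    · exact hmin ⟨hB, hZB⟩ h
  have hfin : (bd G A₀).Finite := by
    rw [← Set.encard_lt_top_iff]
    exact (hmin Z (small_finite hZ) subset_rfl).trans_lt (hZ.subset bd_sub).encard_lt_top
  obtain ⟨e, he, hsub⟩ := exists_inj_of_encard (ω 0) (hlt A₀ hA₀ hZA₀).le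
  refine ⟨e, Set.finite_empty, he, by simp, ?_⟩
  intro A hA _ heA
  rw [Set.sdiff_empty]
  have h1 := hmin (A ∪ A₀) (hA.union hA₀) (hZA₀.trans Set.subset_union_right)
  have h2 : bd G (A ∪ A₀) ⊆ bd G A ∪ (bd G A₀ \ Set.range e) := by
    rintro v ⟨hv, w, hw, hvw⟩
    by_cases hvA : v ∈ A
    · exact Or.inl ⟨hvA, w, fun h => hw (Or.inl h), hvw⟩
    · exact Or.inr ⟨⟨hv.resolve_left hvA, w, fun h => hw (Or.inr h), hvw⟩, fun h => hvA (heA h)⟩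
  have h3 := (h1.trans (Set.encard_le_encard h2)).trans (Set.encard_union_le _ _)
  rw [← Set.encard_sdiff_add_encard_of_subset hsub, add_comm] at h3
  have h4 := (ENat.add_le_add_iff_right ((hfin.sdiff (t := Set.range e)).encard_lt_top.ne)).1 h3
  have h5 : (Set.range e).encard = m := by
    rw [← Set.image_univ, he.encard_image]; simp
  rwa [h5] at h4

theorem OE.good_ext (h : OE G ω) (hb : ∀ κ, ¬ Bdd G ω κ) {k : ℕ} {F : Set V} {e : Fin (k + 1) → V}
    (hg : Good G ω F e) (j : Fin (k + 1)) :
    ∃ w, w ∉ F ∧ w ∉ Set.range e ∧ G.Adj (e j) w ∧ Good G ω (F ∪ {e j}) (Function.update e j w) := by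
  by_contra hcon
  push Not at hcon
  set D : Set V := F ∪ {e j} with hD
  have hDf : D.Finite := hg.fin.union (Set.finite_singleton _)
  let 𝒢 : Set (Set V) := {A | Small G ω A ∧ F ⊆ A ∧ Set.range e ⊆ A ∧ (bd G A \ D).encard ≤ k}
  have hne : 𝒢.Nonempty := by
    refine ⟨F ∪ Set.range e, small_finite (hg.fin.union (Set.finite_range e)),
      Set.subset_union_left, Set.subset_union_right, ?_⟩
    have : bd G (F ∪ Set.range e) \ D ⊆ e '' {j}ᶜ := by
      rintro v ⟨hv, hvD⟩
      rcases bd_sub hv with h1 | ⟨i, rfl⟩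
      · exact (hvD (Or.inl h1)).elim
      · refine ⟨i, ?_, rfl⟩
        rintro rfl
        exact hvD (Or.inr rfl)
    refine (Set.encard_le_encard this).trans ((Set.encard_image_le _ _).trans ?_)
    have h1 : ({j}ᶜ : Set (Fin (k+1))).encard = (({j}ᶜ : Finset (Fin (k+1))).card : ℕ∞) := by
      rw [← Set.encard_coe_eq_coe_finsetCard]; simp
    rw [h1, Finset.card_compl]; simp
  have hcup : ∀ A ∈ 𝒢, ∀ B ∈ 𝒢, A ∪ B ∈ 𝒢 := by
    rintro A ⟨hA1, hA2, hA3, hA4⟩ B ⟨hB1, hB2, hB3, hB4⟩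
    refine ⟨hA1.union hB1, hA2.trans Set.subset_union_left, hA3.trans Set.subset_union_left, ?_⟩
    have h1 := (bd_submod (G := G) A B D).trans (add_le_add hA4 hB4)
    have h2 := hg.link (A ∩ B) (hA1.mono Set.inter_subset_left) (Set.subset_inter hA2 hB2)
      (Set.subset_inter hA3 hB3)
    refine enat_aux h1 ?_
    have h3 : (bd G (A ∩ B) \ F).encard ≤ (bd G (A ∩ B) \ D).encard + 1 := by
      have : bd G (A ∩ B) \ F ⊆ (bd G (A ∩ B) \ D) ∪ {e j} := by
        rintro v ⟨hv, hvF⟩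
        by_cases hvj : v = e j
        · exact Or.inr hvj
        · exact Or.inl ⟨hv, by simp [hD, hvF, hvj]⟩
      refine (Set.encard_le_encard this).trans ((Set.encard_union_le _ _).trans ?_)
      rw [Set.encard_singleton]
    have h4 := h2.trans h3
    push_cast at h4
    exact (ENat.add_le_add_iff_right (by simp)).1 h4
  have hdir : ∀ A ∈ 𝒢, ∀ B ∈ 𝒢, ∃ D ∈ 𝒢, A ⊆ D ∧ B ⊆ D := fun A hA B hB =>
    ⟨_, hcup A hA B hB, Set.subset_union_left, Set.subset_union_right⟩
  have hbdD := bd_sUnion_le (G := G) (D := D) hne hdir (fun A hA => hA.2.2.2)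
  obtain ⟨A₁, hA₁⟩ := hne
  have hFU : F ⊆ ⋃₀ 𝒢 := hA₁.2.1.trans (Set.subset_sUnion_of_mem hA₁)
  have heU : Set.range e ⊆ ⋃₀ 𝒢 := hA₁.2.2.1.trans (Set.subset_sUnion_of_mem hA₁)
  have hnb : ∀ w, G.Adj (e j) w → w ∈ ⋃₀ 𝒢 := by
    intro w hw
    by_cases hwF : w ∈ F
    · exact hFU hwF
    by_cases hwe : w ∈ Set.range e
    · exact heU hwe
    have h1 := hcon w hwF hwe hw
    have h2 : ∃ A, Small G ω A ∧ D ⊆ A ∧ Set.range (Function.update e j w) ⊆ A ∧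
        (bd G A \ D).encard < (k + 1 : ℕ) := by
      by_contra h3
      push Not at h3
      apply h1
      refine ⟨hDf, ?_, ?_, h3⟩
      · intro a b hab
        by_cases ha : a = j <;> by_cases hb : b = j
        · rw [ha, hb]
        · subst ha
          rw [Function.update_self, Function.update_of_ne hb] at hab
          exact (hwe ⟨b, hab.symm⟩).elim
        · subst hb
          rw [Function.update_self, Function.update_of_ne ha] at hab
          exact (hwe ⟨a, hab⟩).elim
        · rw [Function.update_of_ne ha, Function.update_of_ne hb] at hab
          exact hg.inj hab
      · intro i
        by_cases hi : i = j
        · subst hi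
          rw [Function.update_self]
          rintro (h | h)
          · exact hwF h
          · exact hwe ⟨i, h.symm⟩
        · rw [Function.update_of_ne hi]
          rintro (h | h)
          · exact hg.disj i h
          · exact hi (hg.inj h)
    obtain ⟨A, hA1, hA2, hA3, hA4⟩ := h2
    refine ⟨A, ⟨hA1, Set.subset_union_left.trans hA2, ?_, ?_⟩, hA3 ⟨j, by simp⟩⟩
    · rintro _ ⟨i, rfl⟩
      by_cases hi : i = j
      · exact hi ▸ hA2 (Or.inr rfl)
      · exact hA3 ⟨i, by rw [Function.update_of_ne hi]⟩
    · push_cast at hA4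
      exact Order.le_of_lt_add_one hA4
  have hbdF : (bd G (⋃₀ 𝒢) \ F).encard ≤ k := by
    refine (Set.encard_le_encard ?_).trans hbdD
    rintro v ⟨hv, hvF⟩
    refine ⟨hv, ?_⟩
    rintro (h1 | h1)
    · exact hvF h1
    · obtain ⟨_, w, hw, hvw⟩ := hv
      rw [h1] at hvw
      exact hw (hnb w hvw)
  have hBf : (bd G (⋃₀ 𝒢)).Finite :=
    ((Set.finite_of_encard_le_coe hbdF).union hg.fin).subset (by
      intro v hv
      by_cases hvF : v ∈ F
      · exact Or.inr hvF
      · exact Or.inl ⟨hv, hvF⟩)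
  have hns : ¬ Small G ω (⋃₀ 𝒢) := by
    intro hs
    have := (hg.link _ hs hFU heU).trans hbdF
    have := Nat.cast_le.1 this
    omega
  have hC : C G ω (bd G (⋃₀ 𝒢)) ⊆ ⋃₀ 𝒢 := (h.dich _).resolve_right fun h' => hns ⟨_, hBf, h'⟩
  set B := bd G (⋃₀ 𝒢) with hB
  apply hb (k + D.ncard + B.ncard)
  intro Z hZ
  obtain ⟨A, hA, hsub⟩ := finite_sub_directed ⟨A₁, hA₁⟩ hdir (hZ.inter_of_left (⋃₀ 𝒢))
    Set.inter_subset_right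
  refine ⟨A ∪ (C G ω B)ᶜ, hA.1.union (h.small_compl_C hBf), ?_, ?_⟩
  · intro z hz
    by_cases hzU : z ∈ ⋃₀ 𝒢
    · exact Or.inl (hsub ⟨hz, hzU⟩)
    · exact Or.inr fun h' => hzU (hC h')
  · have h1 : bd G (C G ω B)ᶜ ⊆ B := by
      rintro v ⟨hv, w, hw, hvw⟩
      by_contra hvB
      have hw : w ∈ C G ω B := not_not.1 hw
      exact hv (C_closed hw (RO.adj hvw.symm (Set.disjoint_left.1 C_disj hw) hvB))
    have h2 : bd G (A ∪ (C G ω B)ᶜ) ⊆ (bd G A \ D) ∪ D ∪ B := by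
      intro v hv
      rcases bd_union_sub hv with h3 | h3
      · by_cases hvD : v ∈ D
        · exact Or.inl (Or.inr hvD)
        · exact Or.inl (Or.inl ⟨h3, hvD⟩)
      · exact Or.inr (h1 h3)
    refine (Set.encard_le_encard h2).trans ((Set.encard_union_le _ _).trans ?_)
    push_cast
    rw [hDf.cast_ncard_eq, hBf.cast_ncard_eq]
    exact add_le_add ((Set.encard_union_le _ _).trans (add_le_add hA.2.2.2 le_rfl)) le_rfl

theorem OE.good_round (h : OE G ω) (hb : ∀ κ, ¬ Bdd G ω κ) {k : ℕ} {F : Set V} {e : Fin (k + 1) → V}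
    (hg : Good G ω F e) : ∃ e' : Fin (k + 1) → V, Good G ω (F ∪ Set.range e) e' ∧
      ∀ j, G.Adj (e j) (e' j) := by
  have key : ∀ s : Finset (Fin (k + 1)), ∃ e' : Fin (k + 1) → V, Good G ω (F ∪ e '' s) e' ∧
      (∀ j ∈ s, G.Adj (e j) (e' j)) ∧ (∀ j, j ∉ s → e' j = e j) := by
    intro s
    induction s using Finset.induction_on with
    | empty => exact ⟨e, by simpa using hg, by simp, by simp⟩
    | insert j s hj ih =>
      obtain ⟨e', h1, h2, h3⟩ := ih
      obtain ⟨w, hw1, hw2, hw3, hw4⟩ := h.good_ext hb h1 j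
      refine ⟨Function.update e' j w, ?_, ?_, ?_⟩
      · rw [h3 j hj, Set.union_assoc] at hw4
        convert hw4 using 2
        rw [Finset.coe_insert, Set.image_insert_eq, Set.insert_eq, Set.union_comm]
      · intro i hi
        by_cases hij : i = j
        · subst hij
          rw [Function.update_self, ← h3 i hj]
          exact hw3
        · rw [Function.update_of_ne hij]
          exact h2 i (by simpa [hij] using hi)
      · intro i hi
        rw [Finset.mem_insert, not_or] at hi
        rw [Function.update_of_ne hi.1, h3 i hi.2]
  obtain ⟨e', h1, h2, _⟩ := key Finset.univ
  exact ⟨e', by simpa using h1, fun j => h2 j (Finset.mem_univ j)⟩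

theorem OE.exists_bdd (h : OE G ω) {k : ℕ}
    (hk : ¬ ∃ f : Fin (k + 1) → ℕ → V, (∀ i, InEnd G ω (f i)) ∧ DisjointRays f) :
    ∃ κ, Bdd G ω κ := by
  by_contra hb
  push Not at hb
  apply hk
  obtain ⟨e₀, he₀⟩ := good_init (hb (k + 1))
  let St := {p : Set V × (Fin (k + 1) → V) // Good G ω p.1 p.2}
  have step : ∀ p : St, ∃ q : St, q.1.1 = p.1.1 ∪ Set.range p.1.2 ∧ ∀ j, G.Adj (p.1.2 j) (q.1.2 j) := by
    rintro ⟨⟨F, e⟩, hg⟩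
    obtain ⟨e', h1, h2⟩ := h.good_round hb hg
    exact ⟨⟨⟨_, e'⟩, h1⟩, rfl, h2⟩
  choose nx hnx1 hnx2 using step
  let s : ℕ → St := fun n => nx^[n] ⟨⟨∅, e₀⟩, he₀⟩
  have hs : ∀ n, s (n + 1) = nx (s n) := fun n => Function.iterate_succ_apply' _ _ _
  have hmem : ∀ n j, n < j → ∀ i, (s n).1.2 i ∈ (s j).1.1 := by
    intro n j hnj i
    induction j, hnj using Nat.le_induction with
    | base => rw [hs, hnx1]; exact Or.inr ⟨i, rfl⟩
    | succ j _ ih => rw [hs, hnx1]; exact Or.inl ih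
  have hinj : ∀ n n' i i', (s n).1.2 i = (s n').1.2 i' → n = n' := by
    intro n n' i i' heq
    by_contra hne
    rcases lt_or_gt_of_ne hne with hlt | hlt
    · exact (s n').2.disj i' (heq ▸ hmem n n' hlt i)
    · exact (s n).2.disj i (heq ▸ hmem n' n hlt i')
  have hr : ∀ i, IsRay G (fun n => (s n).1.2 i) := by
    refine fun i => ⟨fun n n' hn => hinj _ _ _ _ hn, fun n => ?_⟩
    simp only [hs]; exact hnx2 _ _
  refine ⟨fun i n => (s n).1.2 i, fun i => ⟨hr i, h.one _ (hr i)⟩, ?_⟩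
  intro i i' hne
  rw [Set.disjoint_left]
  rintro _ ⟨n, rfl⟩ ⟨n', hn⟩
  simp only at hn
  obtain rfl := hinj _ _ _ _ hn
  exact hne ((s n').2.inj hn).symm

end P2


section P3
open scoped Pointwise
variable {V : Type} {G : SimpleGraph V} {ω : ℕ → V}

/-- Support of an automorphism. -/
def supp {V : Type} {G : SimpleGraph V} (g : G ≃g G) : Set V := {v | g • v ≠ v}

theorem not_mem_supp {g : G ≃g G} {v : V} : v ∉ supp g ↔ g • v = v := not_not

theorem aut_ext {g h : G ≃g G} (H : ∀ v : V, g • v = h • v) : g = h := RelIso.ext H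

theorem exists_moved {g : G ≃g G} (h : g ≠ 1) : ∃ v : V, g • v ≠ v := by
  by_contra hc
  push Not at hc
  exact h (aut_ext fun v => by rw [hc v, one_smul])

theorem supp_smul {g : G ≃g G} {v : V} (h : v ∈ supp g) : g • v ∈ supp g :=
  fun h' => h (smul_left_cancel g h')

theorem supp_inv (g : G ≃g G) : supp g⁻¹ = supp g := by
  ext v
  simp only [supp, Set.mem_ofPred_eq, ne_eq, not_iff_not]
  constructor
  · intro h; rw [inv_smul_eq_iff] at h; exact h.symm
  · intro h; rw [inv_smul_eq_iff]; exact h.symm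

/-- Build an automorphism from two mutually inverse adjacency preserving maps. -/
def mkAut {V : Type} {G : SimpleGraph V} (f f' : V → V) (h1 : ∀ v, f' (f v) = v)
    (h2 : ∀ v, f (f' v) = v) (h3 : ∀ u v, G.Adj u v → G.Adj (f u) (f v))
    (h4 : ∀ u v, G.Adj u v → G.Adj (f' u) (f' v)) : G ≃g G where
  toFun := f
  invFun := f'
  left_inv := h1
  right_inv := h2
  map_rel_iff' := by
    intro a b
    exact ⟨fun h => by simpa [h1] using h4 _ _ h, h3 a b⟩

theorem mkAut_smul {f f' : V → V} {h1 h2 h3 h4} (v : V) :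
    (mkAut (G := G) f f' h1 h2 h3 h4) • v = f v := rfl

open Classical in
/-- Infinite product of automorphisms with disjoint supports, as a function. -/
noncomputable def pf {V : Type} {G : SimpleGraph V} (f : ℕ → G ≃g G) (s : Set ℕ) (v : V) : V :=
  if h : ∃ n, n ∈ s ∧ f n • v ≠ v then f h.choose • v else v

theorem pf_of {f : ℕ → G ≃g G} (hd : Pairwise fun i j => Disjoint (supp (f i)) (supp (f j)))
    {s : Set ℕ} {n : ℕ} (hn : n ∈ s) {v : V} (hv : v ∈ supp (f n)) : pf f s v = f n • v := by
  have h : ∃ n, n ∈ s ∧ f n • v ≠ v := ⟨n, hn, hv⟩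
  rw [pf, dif_pos h]
  have : h.choose = n := by
    by_contra hne
    exact Set.disjoint_left.1 (hd hne) h.choose_spec.2 hv
  rw [this]

theorem pf_not {f : ℕ → G ≃g G} {s : Set ℕ} {v : V} (hv : ∀ n ∈ s, v ∉ supp (f n)) :
    pf f s v = v := by
  have h : ¬ ∃ n, n ∈ s ∧ f n • v ≠ v := fun ⟨n, hn, h⟩ => hv n hn h
  rw [pf, dif_neg h]

theorem pf_inv {f : ℕ → G ≃g G} (hd : Pairwise fun i j => Disjoint (supp (f i)) (supp (f j)))
    {s : Set ℕ} (v : V) : pf (fun n => (f n)⁻¹) s (pf f s v) = v := by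
  have hd' : Pairwise fun i j => Disjoint (supp (f i)⁻¹) (supp (f j)⁻¹) := by
    simpa only [supp_inv] using hd
  by_cases h : ∃ n ∈ s, v ∈ supp (f n)
  · obtain ⟨n, hn, hv⟩ := h
    rw [pf_of hd hn hv, pf_of hd' hn (by rw [supp_inv]; exact supp_smul hv), inv_smul_smul]
  · push Not at h
    rw [pf_not h, pf_not (by simpa only [supp_inv] using h)]

theorem pf_pair {f : ℕ → G ≃g G} (hd : Pairwise fun i j => Disjoint (supp (f i)) (supp (f j)))
    {s : Set ℕ} (v w : V) : ∃ g : G ≃g G, pf f s v = g • v ∧ pf f s w = g • w := by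
  by_cases h : ∃ n ∈ s, v ∈ supp (f n) <;> by_cases h' : ∃ n ∈ s, w ∈ supp (f n)
  · obtain ⟨n, hn, hv⟩ := h
    obtain ⟨m, hm, hw⟩ := h'
    by_cases hnm : n = m
    · subst hnm
      exact ⟨f n, pf_of hd hn hv, pf_of hd hn hw⟩
    · refine ⟨f n * f m, ?_, ?_⟩
      · rw [pf_of hd hn hv, mul_smul, not_mem_supp.1 (Set.disjoint_left.1 (hd hnm) hv)]
      · rw [pf_of hd hm hw, mul_smul,
          not_mem_supp.1 (Set.disjoint_right.1 (hd hnm) (supp_smul hw))]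
  · obtain ⟨n, hn, hv⟩ := h
    push Not at h'
    exact ⟨f n, pf_of hd hn hv, (pf_not h').trans (not_mem_supp.1 (h' n hn)).symm⟩
  · obtain ⟨n, hn, hw⟩ := h'
    push Not at h
    exact ⟨f n, (pf_not h).trans (not_mem_supp.1 (h n hn)).symm, pf_of hd hn hw⟩
  · push Not at h h'
    exact ⟨1, by rw [pf_not h, one_smul], by rw [pf_not h', one_smul]⟩

theorem prod_lemma {f : ℕ → G ≃g G} (h1 : ∀ n, f n ≠ 1)
    (hd : Pairwise fun i j => Disjoint (supp (f i)) (supp (f j))) :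
    Cardinal.continuum ≤ Cardinal.mk (G ≃g G) := by
  have hd' : Pairwise fun i j => Disjoint (supp (f i)⁻¹) (supp (f j)⁻¹) := by
    simpa only [supp_inv] using hd
  have hadj : ∀ (f : ℕ → G ≃g G), (Pairwise fun i j => Disjoint (supp (f i)) (supp (f j))) →
      ∀ s u v, G.Adj u v → G.Adj (pf f s u) (pf f s v) := by
    intro f hd s u v huv
    obtain ⟨g, h1, h2⟩ := pf_pair hd (s := s) u v
    rw [h1, h2]; exact (adj_smul g).2 huv
  let φ : Set ℕ → (G ≃g G) := fun s => mkAut (pf f s) (pf (fun n => (f n)⁻¹) s) (pf_inv hd)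
    (by simpa using pf_inv hd' (s := s)) (hadj f hd s) (hadj _ hd' s)
  have hsub : ∀ s s', φ s = φ s' → s ⊆ s' := by
    intro s s' hs n hn
    by_contra hn'
    obtain ⟨v, hv⟩ := exists_moved (h1 n)
    have h2 : pf f s v = pf f s' v := congrArg (fun g : G ≃g G => g • v) hs
    rw [pf_of hd hn hv, pf_not] at h2
    · exact hv h2
    · intro m hm
      exact Set.disjoint_left.1 (hd (i := n) (j := m) (by rintro rfl; exact hn' hm)) hv
  have hinj : Function.Injective φ := fun s s' h =>
    (hsub s s' h).antisymm (hsub s' s h.symm)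
  have := Cardinal.mk_le_of_injective hinj
  rwa [Cardinal.mk_set, Cardinal.mk_nat, Cardinal.two_power_aleph0] at this

theorem restrict_lemma {O : Set V} {h : G ≃g G} (hO : h • O = O)
    (hN : ∀ u ∈ O, ∀ v, v ∉ O → G.Adj u v → h • v = v) :
    ∃ g : G ≃g G, (∀ v ∈ O, g • v = h • v) ∧ ∀ v, v ∉ O → g • v = v := by
  classical
  have hO' : h⁻¹ • O = O := by
    conv_lhs => rw [← hO]
    rw [inv_smul_smul]
  have m1 : ∀ v, v ∈ O → h • v ∈ O := fun v hv => by
    rw [← hO]; exact Set.smul_mem_smul_set hv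
  have m2 : ∀ v, v ∈ O → h⁻¹ • v ∈ O := fun v hv => by
    rw [← hO']; exact Set.smul_mem_smul_set hv
  have key : ∀ h : G ≃g G, (∀ v, v ∈ O → h • v ∈ O) →
      (∀ u ∈ O, ∀ v, v ∉ O → G.Adj u v → h • v = v) → ∀ u v, G.Adj u v →
      G.Adj (if u ∈ O then h • u else u) (if v ∈ O then h • v else v) := by
    intro h m1 hN u v huv
    by_cases hu : u ∈ O <;> by_cases hv : v ∈ O
    · simp only [if_pos hu, if_pos hv]; exact (adj_smul h).2 huv
    · rw [if_pos hu, if_neg hv, ← hN u hu v hv huv]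
      rw [adj_smul]; exact huv
    · rw [if_pos hv, if_neg hu, ← hN v hv u hu huv.symm]
      rw [adj_smul]; exact huv
    · rw [if_neg hu, if_neg hv]; exact huv
  refine ⟨mkAut (fun v => if v ∈ O then h • v else v) (fun v => if v ∈ O then h⁻¹ • v else v)
    ?_ ?_ (key h m1 hN) (key h⁻¹ m2 ?_), ?_, ?_⟩
  · intro v
    by_cases hv : v ∈ O
    · simp only [if_pos hv, if_pos (m1 v hv), inv_smul_smul]
    · simp only [if_neg hv]
  · intro v
    by_cases hv : v ∈ O
    · simp only [if_pos hv, if_pos (m2 v hv), smul_inv_smul]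
    · simp only [if_neg hv]
  · intro u hu v hv huv
    rw [inv_smul_eq_iff]; exact (hN u hu v hv huv).symm
  · intro v hv
    rw [mkAut_smul]; exact if_pos hv
  · intro v hv
    rw [mkAut_smul]; exact if_neg hv

theorem swap_lemma {K K' : Set V} {h : G ≃g G} (hK : h • K = K') (hd : Disjoint K K')
    (hE : ∀ u ∈ K, ∀ v ∈ K', ¬ G.Adj u v)
    (hN : ∀ u, u ∈ K ∨ u ∈ K' → ∀ v, v ∉ K → v ∉ K' → G.Adj u v → h • v = v) :
    ∃ g : G ≃g G, (∀ v ∈ K, g • v = h • v) ∧ ∀ v, v ∉ K → v ∉ K' → g • v = v := by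
  classical
  let σ : V → V := fun v => if v ∈ K then h • v else if v ∈ K' then h⁻¹ • v else v
  have s1 : ∀ v, v ∈ K → σ v = h • v := fun v hv => if_pos hv
  have s2 : ∀ v, v ∈ K' → σ v = h⁻¹ • v := fun v hv =>
    (if_neg (Set.disjoint_right.1 hd hv)).trans (if_pos hv)
  have s3 : ∀ v, v ∉ K → v ∉ K' → σ v = v := fun v hv hv' => (if_neg hv).trans (if_neg hv')
  have m1 : ∀ v, v ∈ K → h • v ∈ K' := fun v hv => hK ▸ Set.smul_mem_smul_set hv
  have m2 : ∀ v, v ∈ K' → h⁻¹ • v ∈ K := fun v hv => by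
    rw [← hK] at hv; exact Set.mem_smul_set_iff_inv_smul_mem.1 hv
  have inv : ∀ v, σ (σ v) = v := by
    intro v
    by_cases hv : v ∈ K
    · rw [s1 v hv, s2 _ (m1 v hv), inv_smul_smul]
    by_cases hv' : v ∈ K'
    · rw [s2 v hv', s1 _ (m2 v hv'), smul_inv_smul]
    · rw [s3 v hv hv', s3 v hv hv']
  have half : ∀ u v, u ∈ K ∨ u ∈ K' → v ∉ K → v ∉ K' → G.Adj u v → G.Adj (σ u) v := by
    intro u v hu hv hv' huv
    have h1 := hN u hu v hv hv' huv
    rcases hu with hu | hu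
    · rw [s1 u hu, ← h1, adj_smul]; exact huv
    · rw [s2 u hu]
      have h2 : h⁻¹ • v = v := by rw [inv_smul_eq_iff]; exact h1.symm
      rw [← h2, adj_smul]; exact huv
  have adj : ∀ u v, G.Adj u v → G.Adj (σ u) (σ v) := by
    intro u v huv
    by_cases hu : u ∈ K ∨ u ∈ K' <;> by_cases hv : v ∈ K ∨ v ∈ K'
    · rcases hu with hu | hu <;> rcases hv with hv | hv
      · rw [s1 u hu, s1 v hv, adj_smul]; exact huv
      · exact (hE u hu v hv huv).elim
      · exact (hE v hv u hu huv.symm).elim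
      · rw [s2 u hu, s2 v hv, adj_smul]; exact huv
    · push Not at hv
      rw [s3 v hv.1 hv.2]
      exact half u v hu hv.1 hv.2 huv
    · push Not at hu
      rw [s3 u hu.1 hu.2]
      exact (half v u hv hu.1 hu.2 huv.symm).symm
    · push Not at hu hv
      rw [s3 u hu.1 hu.2, s3 v hv.1 hv.2]; exact huv
  exact ⟨mkAut σ σ inv inv adj adj, fun v hv => s1 v hv, fun v hv hw => s3 v hv hw⟩

/-- `K` is a component of `G - L`. -/
def IsComp {V : Type} (G : SimpleGraph V) (L K : Set V) : Prop := ∃ a, a ∉ L ∧ K = cmp G L a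

theorem IsComp.nonempty {L K : Set V} (h : IsComp G L K) : K.Nonempty := by
  obtain ⟨a, ha, rfl⟩ := h
  exact ⟨a, .refl ha⟩

theorem IsComp.eq_cmp {L K : Set V} (h : IsComp G L K) {v : V} (hv : v ∈ K) : K = cmp G L v := by
  obtain ⟨a, ha, rfl⟩ := h
  exact cmp_eq hv

theorem isComp_cmp {L : Set V} {v : V} (hv : v ∉ L) : IsComp G L (cmp G L v) := ⟨v, hv, rfl⟩

theorem mem_cmp_self {L : Set V} {v : V} (hv : v ∉ L) : v ∈ cmp G L v := .refl hv

theorem IsComp.disj_L {L K : Set V} (h : IsComp G L K) {v : V} (hv : v ∈ K) : v ∉ L := by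
  obtain ⟨a, ha, rfl⟩ := h
  exact RO.right hv

theorem IsComp.disjoint {L K K' : Set V} (h : IsComp G L K) (h' : IsComp G L K') (hne : K ≠ K') :
    Disjoint K K' := by
  rw [Set.disjoint_left]
  intro v hv hv'
  exact hne ((h.eq_cmp hv).trans (h'.eq_cmp hv').symm)

theorem IsComp.nbr {L K : Set V} (h : IsComp G L K) {u v : V} (hu : u ∈ K) (huv : G.Adj u v)
    (hv : v ∉ L) : v ∈ K := by
  obtain ⟨a, ha, rfl⟩ := h
  exact RO.step hu huv hv

theorem smul_set_fix {L : Set V} {g : G ≃g G} (hg : ∀ l ∈ L, g • l = l) : g • L = L := by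
  ext v
  constructor
  · rintro ⟨w, hw, rfl⟩
    simp only [hg w hw]; exact hw
  · intro hv
    exact ⟨v, hv, hg v hv⟩

theorem IsComp.smul {L K : Set V} (h : IsComp G L K) (g : G ≃g G) : IsComp G (g • L) (g • K) := by
  obtain ⟨a, ha, rfl⟩ := h
  exact ⟨g • a, by rwa [Set.smul_mem_smul_set_iff], cmp_smul g⟩

/-- Components affected by the pointwise stabilizer of `L`. -/
def Aff {V : Type} (G : SimpleGraph V) (L : Set V) : Set (Set V) :=
  {K | IsComp G L K ∧ ∃ g : G ≃g G, (∀ l ∈ L, g • l = l) ∧ ∃ v ∈ K, g • v ≠ v}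

theorem comp_restrict {L K : Set V} (hK : IsComp G L K) {h : G ≃g G} (hL : ∀ l ∈ L, h • l = l)
    (hKK : h • K = K) : ∃ g : G ≃g G, (∀ v ∈ K, g • v = h • v) ∧ ∀ v, v ∉ K → g • v = v :=
  restrict_lemma hKK fun u hu v hv huv => hL v (by
    by_contra hvL
    exact hv (hK.nbr hu huv hvL))

theorem comp_swap {L K K' : Set V} (hK : IsComp G L K) (hK' : IsComp G L K') (hne : K ≠ K')
    {h : G ≃g G} (hL : ∀ l ∈ L, h • l = l) (hKK : h • K = K') :
    ∃ g : G ≃g G, (∀ v ∈ K, g • v = h • v) ∧ ∀ v, v ∉ K → v ∉ K' → g • v = v := by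
  have hd := hK.disjoint hK' hne
  refine swap_lemma hKK hd ?_ ?_
  · intro u hu v hv huv
    exact Set.disjoint_right.1 hd hv (hK.nbr hu huv (hK'.disj_L hv))
  · intro u hu v hv hv' huv
    apply hL
    by_contra hvL
    rcases hu with hu | hu
    · exact hv (hK.nbr hu huv hvL)
    · exact hv' (hK'.nbr hu huv hvL)

theorem aff_step {L : Set V} (hinf : (Aff G L).Infinite) {P : Set (Set V)} (hP : P.Finite) :
    ∃ g : G ≃g G, g ≠ 1 ∧ ∃ Q : Set (Set V), Q.Finite ∧ (∀ K ∈ Q, IsComp G L K) ∧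
      supp g ⊆ ⋃₀ Q ∧ Disjoint Q P := by
  have h2 : ∀ K : Set V, ∃ g : G ≃g G, K ∈ Aff G L → ((∀ l ∈ L, g • l = l) ∧ ∃ v ∈ K, g • v ≠ v) := by
    intro K
    by_cases hK : K ∈ Aff G L
    · obtain ⟨g, hg⟩ := hK.2
      exact ⟨g, fun _ => hg⟩
    · exact ⟨1, fun h => (hK h).elim⟩
  choose γ hγ using h2
  have swapcase : ∀ K K' : Set V, IsComp G L K → IsComp G L K' → K ≠ K' → K ∉ P → K' ∉ P →
      ∀ h : G ≃g G, (∀ l ∈ L, h • l = l) → h • K = K' →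
      ∃ g : G ≃g G, g ≠ 1 ∧ ∃ Q : Set (Set V), Q.Finite ∧ (∀ K ∈ Q, IsComp G L K) ∧
        supp g ⊆ ⋃₀ Q ∧ Disjoint Q P := by
    intro K K' hK hK' hne hKP hKP' h hL hKK
    obtain ⟨g, hg1, hg2⟩ := comp_swap hK hK' hne hL hKK
    obtain ⟨v, hv⟩ := hK.nonempty
    refine ⟨g, ?_, {K, K'}, by simp, by simp [hK, hK'], ?_, by simp [hKP, hKP']⟩
    · rintro rfl
      have h3 := hg1 v hv
      rw [one_smul] at h3
      have h4 : v ∈ K' := by rw [h3, ← hKK]; exact Set.smul_mem_smul_set hv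
      exact Set.disjoint_left.1 (hK.disjoint hK' hne) hv h4
    · intro v hv
      by_contra hv'
      simp only [Set.sUnion_insert, Set.sUnion_singleton, Set.mem_union, not_or] at hv'
      exact hv (hg2 v hv'.1 hv'.2)
  have hinf' := hinf.sdiff hP
  by_cases hc1 : ∃ K ∈ Aff G L \ P, γ K • K = K
  · obtain ⟨K, ⟨hK, hKP⟩, hKK⟩ := hc1
    obtain ⟨g, hg1, hg2⟩ := comp_restrict hK.1 (hγ K hK).1 hKK
    refine ⟨g, ?_, {K}, by simp, by simp [hK.1], ?_, by simp [hKP]⟩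
    · rintro rfl
      obtain ⟨v, hv, hne⟩ := (hγ K hK).2
      exact hne (by rw [← hg1 v hv, one_smul])
    · intro v hv
      by_contra hv'
      simp only [Set.sUnion_singleton] at hv'
      exact hv (hg2 v hv')
  push Not at hc1
  have hcomp : ∀ K ∈ Aff G L, IsComp G L (γ K • K) := by
    intro K hK
    have := hK.1.smul (γ K)
    rwa [smul_set_fix (hγ K hK).1] at this
  by_cases hc2 : ∃ K ∈ Aff G L \ P, γ K • K ∉ P
  · obtain ⟨K, hK, hKK⟩ := hc2
    exact swapcase K (γ K • K) hK.1.1 (hcomp K hK.1) (hc1 K hK).symm hK.2 hKK (γ K) (hγ K hK.1).1 rfl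
  push Not at hc2
  obtain ⟨K, hK, K', hK', hne, heq⟩ := hinf'.exists_ne_map_eq_of_mapsTo
    (f := fun K => γ K • K) (t := P) (fun K hK => hc2 K hK) hP
  refine swapcase K K' hK.1.1 hK'.1.1 hne hK.2 hK'.2 ((γ K')⁻¹ * γ K) ?_ ?_
  · intro l hl
    rw [mul_smul, (hγ K hK.1).1 l hl, inv_smul_eq_iff, (hγ K' hK'.1).1 l hl]
  · rw [mul_smul, heq, inv_smul_smul]

theorem aff_finite (hc : ¬ Cardinal.continuum ≤ Cardinal.mk (G ≃g G)) (L : Set V) :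
    (Aff G L).Finite := by
  by_contra hinf
  have hinf : (Aff G L).Infinite := hinf
  classical
  obtain ⟨f, hf1, hf2⟩ := exists_seq_of_forall_finset_exists'
    (P := fun p : (G ≃g G) × Set (Set V) => p.1 ≠ 1 ∧ p.2.Finite ∧ (∀ K ∈ p.2, IsComp G L K) ∧
      supp p.1 ⊆ ⋃₀ p.2) (r := fun p q => Disjoint p.2 q.2)
    (by
      intro s hs
      obtain ⟨g, h1, Q, h2, h3, h4, h5⟩ := aff_step hinf (P := ⋃ p ∈ s, p.2)
        (s.finite_toSet.biUnion fun p hp => (hs p hp).2.1)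
      refine ⟨(g, Q), ⟨h1, h2, h3, h4⟩, fun p hp => ?_⟩
      exact (h5.mono_right (Set.subset_biUnion_of_mem (u := fun p : (G ≃g G) × Set (Set V) => p.2) hp)).symm)
  apply hc
  refine prod_lemma (f := fun n => (f n).1) (fun n => (hf1 n).1) ?_
  intro i j hij
  rw [Set.disjoint_left]
  intro v hv hv'
  obtain ⟨K, hK, h1⟩ := (hf1 i).2.2.2 hv
  obtain ⟨K', hK', h1'⟩ := (hf1 j).2.2.2 hv'
  have hne : K ≠ K' := by
    rintro rfl
    exact Set.disjoint_left.1 (hf2 hij) hK hK'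
  exact Set.disjoint_left.1 (((hf1 i).2.2.1 K hK).disjoint ((hf1 j).2.2.1 K' hK') hne) h1 h1'

theorem OE.small_fix (h : OE G ω) (hc : ¬ Cardinal.continuum ≤ Cardinal.mk (G ≃g G)) {A : Set V}
    (hA : Small G ω A) : ∃ Y : Set V, Y.Finite ∧
      ∀ g : G ≃g G, (∀ y ∈ Y, g • y = y) → ∀ v ∈ A, g • v = v := by
  refine h.small_induction (Pr := fun A => ∃ Y : Set V, Y.Finite ∧
      ∀ g : G ≃g G, (∀ y ∈ Y, g • y = y) → ∀ v ∈ A, g • v = v) ?_ hA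
  intro S hS B hB
  have h2 : ∀ K : Set V, ∃ Y : Set V, Y.Finite ∧ ((∃ b ∈ B, b ∉ S ∧ K = cmp G S b) →
      ∀ g : G ≃g G, (∀ y ∈ Y, g • y = y) → ∀ v ∈ K, g • v = v) := by
    intro K
    by_cases hK : ∃ b ∈ B, b ∉ S ∧ K = cmp G S b
    · obtain ⟨b, hb, hbS, rfl⟩ := hK
      obtain ⟨Y, hY, h3⟩ := hB b hb hbS
      exact ⟨Y, hY, fun _ => h3⟩
    · exact ⟨∅, Set.finite_empty, fun h => (hK h).elim⟩
  choose Y hY hY2 using h2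
  refine ⟨S ∪ ⋃ K ∈ Aff G S, Y K, hS.union ((aff_finite hc S).biUnion fun K _ => hY K), ?_⟩
  intro g hg v hv
  by_cases hvS : v ∈ S
  · exact hg v (Or.inl hvS)
  by_cases hK : cmp G S v ∈ Aff G S
  · refine hY2 (cmp G S v) ⟨v, hv, hvS, rfl⟩ g (fun y hy => hg y (Or.inr ?_)) v (mem_cmp_self hvS)
    exact Set.mem_biUnion hK hy
  · by_contra hne
    exact hK ⟨isComp_cmp hvS, g, fun l hl => hg l (Or.inl hl), v, mem_cmp_self hvS, hne⟩

/-- Automorphisms with small support. -/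
def FF {V : Type} {G : SimpleGraph V} {ω : ℕ → V} (_ : OE G ω) : Subgroup (G ≃g G) where
  carrier := {g | Small G ω (supp g)}
  one_mem' := by
    refine (small_finite Set.finite_empty).mono ?_
    intro v hv
    exact (hv (one_smul _ v)).elim
  mul_mem' := by
    intro a b ha hb
    refine (Small.union ha hb).mono ?_
    intro v hv
    by_contra hv'
    simp only [Set.mem_union, not_or, not_mem_supp] at hv'
    exact hv (by rw [mul_smul, hv'.2, hv'.1])
  inv_mem' := by
    intro a ha
    simpa only [Set.mem_ofPred_eq, supp_inv] using ha

theorem mem_FF (h : OE G ω) {g : G ≃g G} : g ∈ FF h ↔ Small G ω (supp g) := Iff.rfl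

theorem OE.exists_T (h : OE G ω) (hc : ¬ Cardinal.continuum ≤ Cardinal.mk (G ≃g G)) :
    ∃ T : Set V, T.Finite ∧ ∀ g ∈ FF h, (∀ t ∈ T, g • t = t) → g = 1 := by
  by_contra hcon
  push Not at hcon
  classical
  obtain ⟨f, hf1, hf2⟩ := exists_seq_of_forall_finset_exists'
    (P := fun g : G ≃g G => g ∈ FF h ∧ g ≠ 1) (r := fun g g' => Disjoint (supp g) (supp g'))
    (by
      intro s hs
      have hsm : Small G ω (⋃ g ∈ (s : Set (G ≃g G)), supp g) :=
        small_biUnion s.finite_toSet fun g hg => (hs g hg).1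
      obtain ⟨Y, hY, hY2⟩ := h.small_fix hc hsm
      obtain ⟨g, h1, h2, h3⟩ := hcon Y hY
      refine ⟨g, ⟨h1, h3⟩, fun g' hg' => ?_⟩
      rw [Set.disjoint_left]
      intro v hv hv'
      exact hv' (hY2 g h2 v (Set.mem_biUnion hg' hv)))
  exact hc (prod_lemma (fun n => (hf1 n).2) hf2)

end P3


section P4
open scoped Pointwise
variable {V : Type} {G : SimpleGraph V} {ω : ℕ → V}

theorem neumann {K X : Type} [Group K] [MulAction K X] {s : Set (X × X)} (hsf : s.Finite)
    (hs : ∀ p ∈ s, (MulAction.orbit K p.1).Infinite) : ∃ f : K, ∀ p ∈ s, f • p.1 ≠ p.2 := by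
  by_contra hcon
  push Not at hcon
  have hg : ∀ p : X × X, ∃ g : K, ∀ f : K, f • p.1 = p.2 → g • p.1 = p.2 := by
    intro p
    by_cases hp : ∃ f : K, f • p.1 = p.2
    · obtain ⟨g, hg⟩ := hp
      exact ⟨g, fun _ _ => hg⟩
    · exact ⟨1, fun f hf => (hp ⟨f, hf⟩).elim⟩
  choose g hg using hg
  have hcov : ⋃ p ∈ hsf.toFinset, g p • (MulAction.stabilizer K p.1 : Set K) = Set.univ := by
    rw [Set.eq_univ_iff_forall]
    intro f
    obtain ⟨p, hp, hf⟩ := hcon f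
    refine Set.mem_biUnion (x := p) (by simpa using hp) ?_
    rw [Set.mem_smul_set_iff_inv_smul_mem]
    change (g p)⁻¹ • f ∈ MulAction.stabilizer K p.1
    rw [MulAction.mem_stabilizer_iff, smul_eq_mul, mul_smul, hf, inv_smul_eq_iff, hg p f hf]
  obtain ⟨p, hp, hfi⟩ := Subgroup.exists_finiteIndex_of_leftCoset_cover hcov
  have hfin : Finite (MulAction.orbit K p.1) :=
    Finite.of_equiv _ (MulAction.orbitEquivQuotientStabilizer K p.1).symm
  exact hs p (by simpa using hp) (Set.toFinite _)

theorem range_restr_finite {H : Subgroup (G ≃g G)} {L : Set V} (hL : L.Finite)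
    (ho : ∀ l ∈ L, (MulAction.orbit H l).Finite) :
    (Set.range (fun (h : H) (l : L) => h • (l : V))).Finite := by
  have : Finite L := hL
  refine (Set.Finite.pi (fun l : L => ho l.1 l.2)).subset ?_
  rintro _ ⟨h, rfl⟩ l _
  exact ⟨h, rfl⟩

theorem orbit_finite_of_fix {H : Subgroup (G ≃g G)} {L : Set V} (hL : L.Finite)
    (ho : ∀ l ∈ L, (MulAction.orbit H l).Finite) {v : V}
    (hv : ∀ g : G ≃g G, (∀ l ∈ L, g • l = l) → g • v = v) : (MulAction.orbit H v).Finite := by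
  have hR := range_restr_finite hL ho
  have hf : Function.FactorsThrough (fun h : H => h • v) (fun (h : H) (l : L) => h • (l : V)) := by
    intro h h' heq
    have h1 : ((h : G ≃g G)⁻¹ * (h' : G ≃g G)) • v = v := by
      apply hv
      intro l hl
      rw [mul_smul, inv_smul_eq_iff]
      exact (congrFun heq ⟨l, hl⟩).symm
    rw [mul_smul, inv_smul_eq_iff] at h1
    exact h1.symm
  refine (hR.image (Function.extend (fun (h : H) (l : L) => h • (l : V)) (fun h : H => h • v)
    (fun _ => v))).subset ?_
  rintro _ ⟨h, rfl⟩
  exact ⟨_, ⟨h, rfl⟩, hf.extend_apply _ _⟩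

/-- Vertices with finite orbit. -/
def Ofin {V : Type} {G : SimpleGraph V} (H : Subgroup (G ≃g G)) : Set V :=
  {v | (MulAction.orbit H v).Finite}

/-- Invariant proper ideals used for the Zorn lemma. -/
structure NI {V : Type} {G : SimpleGraph V} (H : Subgroup (G ≃g G)) (T : Set V)
    (𝓙 : Set (Set V)) : Prop where
  down : ∀ A B, A ⊆ B → B ∈ 𝓙 → A ∈ 𝓙
  union : ∀ A ∈ 𝓙, ∀ B ∈ 𝓙, A ∪ B ∈ 𝓙
  inv : ∀ g ∈ H, ∀ A ∈ 𝓙, g • A ∈ 𝓙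
  base : ∀ J : Set V, (J \ Ofin H).Finite → J ∈ 𝓙
  proper : ∀ J ∈ 𝓙, ∃ f ∈ H, ∀ t ∈ T, f • t ∉ J

theorem NI.biUnion {H : Subgroup (G ≃g G)} {T : Set V} {𝓙 : Set (Set V)} (h : NI H T 𝓙)
    {ι : Type*} {s : Set ι} (hs : s.Finite) {A : ι → Set V} (hA : ∀ i ∈ s, A i ∈ 𝓙) :
    (⋃ i ∈ s, A i) ∈ 𝓙 := by
  induction s, hs using Set.Finite.induction_on with
  | empty => simpa using h.base ∅ (by simp)
  | insert _ _ ih =>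
    rw [Set.biUnion_insert]
    exact h.union _ (hA _ (by simp)) _ (ih fun i hi => hA i (by simp [hi]))

theorem orbit_smul_infinite {H : Subgroup (G ≃g G)} {g : G ≃g G} (hg : g ∈ H) {v : V} :
    MulAction.orbit H (g • v) = MulAction.orbit H v :=
  MulAction.orbit_smul (⟨g, hg⟩ : H) v

theorem ni_base {H : Subgroup (G ≃g G)} {T : Set V} (hT : T.Finite)
    (hTo : ∀ t ∈ T, (MulAction.orbit H t).Infinite) :
    NI H T {J : Set V | (J \ Ofin H).Finite} where
  down A B hAB hB := hB.subset (Set.sdiff_subset_sdiff_left hAB)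
  union A hA B hB := by
    simp only [Set.mem_ofPred_eq, Set.union_sdiff_distrib] at *
    exact hA.union hB
  inv g hg A hA := by
    refine (hA.image (fun v => g • v)).subset ?_
    rintro _ ⟨⟨v, hv, rfl⟩, h2⟩
    refine ⟨v, ⟨hv, fun h3 => h2 ?_⟩, rfl⟩
    change (MulAction.orbit H (g • v)).Finite
    rw [orbit_smul_infinite hg]
    exact h3
  base J hJ := hJ
  proper J hJ := by
    obtain ⟨f, hf⟩ := neumann (K := H) (X := V) (s := T ×ˢ (J \ Ofin H)) (hT.prod hJ)
      (fun p hp => hTo p.1 hp.1)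
    refine ⟨f, f.2, fun t ht htJ => ?_⟩
    refine hf (t, f • t) ⟨ht, htJ, fun h3 => ?_⟩ rfl
    change (MulAction.orbit H ((f : G ≃g G) • t)).Finite at h3
    rw [orbit_smul_infinite f.2] at h3
    exact hTo t ht h3

theorem exists_max_ni {H : Subgroup (G ≃g G)} {T : Set V} (hT : T.Finite)
    (hTo : ∀ t ∈ T, (MulAction.orbit H t).Infinite) :
    ∃ 𝓙 : Set (Set V), Maximal (NI H T) 𝓙 := by
  obtain ⟨m, _, hm⟩ := zorn_subset_nonempty {𝓙 | NI H T 𝓙} (by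
    intro c hc hchain hne
    refine ⟨⋃₀ c, ⟨?_, ?_, ?_, ?_, ?_⟩, fun s hs => Set.subset_sUnion_of_mem hs⟩
    · rintro A B hAB ⟨𝓙, hJ, hB⟩
      exact ⟨𝓙, hJ, (hc hJ).down A B hAB hB⟩
    · rintro A ⟨𝓙, hJ, hA⟩ B ⟨𝓙', hJ', hB⟩
      rcases hchain.total hJ hJ' with hle | hle
      · exact ⟨𝓙', hJ', (hc hJ').union A (hle hA) B hB⟩
      · exact ⟨𝓙, hJ, (hc hJ).union A hA B (hle hB)⟩
    · rintro g hg A ⟨𝓙, hJ, hA⟩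
      exact ⟨𝓙, hJ, (hc hJ).inv g hg A hA⟩
    · intro J hJ
      obtain ⟨𝓙, h𝓙⟩ := hne
      exact ⟨𝓙, h𝓙, (hc h𝓙).base J hJ⟩
    · rintro J ⟨𝓙, h𝓙, hJ⟩
      exact (hc h𝓙).proper J hJ) _ (ni_base hT hTo)
  exact ⟨m, hm⟩

theorem ideal_caseA {H : Subgroup (G ≃g G)} {T : Set V} {𝓙 : Set (Set V)} (h : NI H T 𝓙)
    (hc : ¬ Cardinal.continuum ≤ Cardinal.mk (G ≃g G)) {L : Set V} (hL : L.Finite)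
    (ho : ∀ l ∈ L, (MulAction.orbit H l).Finite) {𝒦 : Set (Set V)}
    (hK : ∀ K ∈ 𝒦, K ∈ 𝓙 ∧ IsComp G L K) : ⋃₀ 𝒦 ∈ 𝓙 := by
  have h1 : (⋃ K ∈ 𝒦 ∩ Aff G L, K) ∈ 𝓙 :=
    h.biUnion ((aff_finite hc L).inter_of_right 𝒦) fun K hK' => (hK K hK'.1).1
  have h2 : Ofin H ∈ 𝓙 := h.base _ (by simp)
  refine h.down _ _ ?_ (h.union _ h1 _ h2)
  rintro v ⟨K, hKK, hv⟩
  by_cases hA : K ∈ Aff G L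
  · exact Or.inl (Set.mem_biUnion (⟨hKK, hA⟩ : K ∈ 𝒦 ∩ Aff G L) hv)
  · right
    refine orbit_finite_of_fix hL ho fun g hg => ?_
    by_contra hne
    exact hA ⟨(hK K hKK).2, g, hg, v, hv, hne⟩

theorem ideal_B1 {H : Subgroup (G ≃g G)} {T : Set V} {𝓙 : Set (Set V)} (h : NI H T 𝓙)
    {L : Set V} (hL : L.Finite) {𝒦 : Set (Set V)}
    (hK : ∀ K ∈ 𝒦, K ∈ 𝓙 ∧ IsComp G L K ∧ ∀ l ∈ L, ∃ u ∈ K, G.Adj u l)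
    {f : G ≃g G} (hf : f ∈ H) (hfL : f • L ≠ L) : ⋃₀ 𝒦 ∩ f • ⋃₀ 𝒦 ∈ 𝓙 := by
  have hfLf : (f • L).Finite := hL.image _
  obtain ⟨x, hxL, hxf⟩ : ∃ x ∈ L, x ∉ f • L := by
    by_contra hcon
    push Not at hcon
    apply hfL
    refine (Set.Finite.eq_of_subset_of_encard_le hL (show L ⊆ f • L from hcon) ?_).symm
    exact Set.encard_image_le _ _
  have h1 : (⋃ K ∈ {K ∈ 𝒦 | ¬ Disjoint K (f • L)}, K) ∈ 𝓙 := by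
    refine h.biUnion ((hfLf.image (fun y => cmp G L y)).subset ?_) fun K hK' => (hK K hK'.1).1
    rintro K ⟨hKK, hnd⟩
    obtain ⟨y, hy1, hy2⟩ := Set.not_disjoint_iff.1 hnd
    exact ⟨y, hy2, ((hK K hKK).2.1.eq_cmp hy1).symm⟩
  have key : ∀ K ∈ 𝒦, Disjoint K (f • L) → ∀ K' ∈ 𝒦, ∀ y ∈ K, y ∈ f • K' →
      f • K' = cmp G (f • L) x := by
    intro K hKK hd K' hK' y hy hy'
    have h2 : IsComp G (f • L) (f • K') := (hK K' hK').2.1.smul f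
    rw [h2.eq_cmp hy']
    obtain ⟨u, hu, hux⟩ := (hK K hKK).2.2 x hxL
    have hyu : RO G L y u := by
      have := (hK K hKK).2.1.eq_cmp hy
      rw [this] at hu
      exact hu
    have hyu' : RO G (f • L) y u := by
      refine hyu.change fun c hc => ?_
      have hcK : c ∈ K := by rw [(hK K hKK).2.1.eq_cmp hy]; exact hc
      exact Set.disjoint_left.1 hd hcK
    exact cmp_eq (hyu'.step hux hxf)
  by_cases hex : ∃ K' ∈ 𝒦, f • K' = cmp G (f • L) x
  · obtain ⟨K', hK', heq⟩ := hex
    refine h.down _ _ ?_ (h.union _ h1 _ (h.inv f hf K' (hK K' hK').1))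
    rintro y ⟨⟨K, hKK, hy⟩, hy'⟩
    by_cases hd : Disjoint K (f • L)
    · right
      obtain ⟨y', ⟨K'', hK'', hy''⟩, rfl⟩ := hy'
      have h3 := key K hKK hd K'' hK'' _ hy (Set.smul_mem_smul_set hy'')
      rw [heq, ← h3]
      exact Set.smul_mem_smul_set hy''
    · exact Or.inl (Set.mem_biUnion (⟨hKK, hd⟩ : K ∈ {K ∈ 𝒦 | ¬ Disjoint K (f • L)}) hy)
  · refine h.down _ _ ?_ h1
    rintro y ⟨⟨K, hKK, hy⟩, hy'⟩
    by_cases hd : Disjoint K (f • L)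
    · obtain ⟨y', ⟨K'', hK'', hy''⟩, rfl⟩ := hy'
      exact (hex ⟨K'', hK'', key K hKK hd K'' hK'' _ hy (Set.smul_mem_smul_set hy'')⟩).elim
    · exact Set.mem_biUnion (⟨hKK, hd⟩ : K ∈ {K ∈ 𝒦 | ¬ Disjoint K (f • L)}) hy

theorem orbit_set_infinite {H : Subgroup (G ≃g G)} {L : Set V} (hL : L.Finite) {l : V} (hl : l ∈ L)
    (ho : (MulAction.orbit H l).Infinite) : (MulAction.orbit H L).Infinite := by
  intro hfin
  apply ho
  have : (⋃ M ∈ MulAction.orbit H L, M).Finite := by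
    refine hfin.biUnion ?_
    rintro _ ⟨h, rfl⟩
    exact hL.image _
  refine this.subset ?_
  rintro _ ⟨h, rfl⟩
  exact Set.mem_biUnion (⟨h, rfl⟩ : h • L ∈ MulAction.orbit H L) (Set.smul_mem_smul_set hl)

theorem ideal_caseB {H : Subgroup (G ≃g G)} {T : Set V} (hT : T.Finite) {𝓙 : Set (Set V)}
    (hmax : Maximal (NI H T) 𝓙)
    {L : Set V} (hL : L.Finite) {l : V} (hl : l ∈ L) (ho : (MulAction.orbit H l).Infinite)
    {𝒦 : Set (Set V)}
    (hK : ∀ K ∈ 𝒦, K ∈ 𝓙 ∧ IsComp G L K ∧ ∀ l ∈ L, ∃ u ∈ K, G.Adj u l) : ⋃₀ 𝒦 ∈ 𝓙 := by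
  have h := hmax.prop
  set W := ⋃₀ 𝒦 with hW
  by_contra hWJ
  have hB1 : ∀ f ∈ H, ∀ f' ∈ H, f • L ≠ f' • L → f • W ∩ f' • W ∈ 𝓙 := by
    intro f hf f' hf' hne
    have h1 := ideal_B1 h hL hK (f := f⁻¹ * f') (H.mul_mem (H.inv_mem hf) hf')
      (fun heq => hne (by rw [mul_smul, inv_smul_eq_iff] at heq; exact heq.symm))
    have h2 := h.inv f hf _ h1
    rwa [Set.smul_set_inter, ← mul_smul, mul_inv_cancel_left] at h2
  let 𝓙' : Set (Set V) := {J | ∃ J0 ∈ 𝓙, ∃ s : Set (G ≃g G), s.Finite ∧ s ⊆ H ∧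
    J ⊆ J0 ∪ ⋃ g ∈ s, g • W}
  have hsub : 𝓙 ⊆ 𝓙' := fun J hJ => ⟨J, hJ, ∅, Set.finite_empty, by simp, by simp⟩
  have hW' : W ∈ 𝓙' := ⟨∅, h.base _ (by simp), {1}, by simp, by simp [H.one_mem], by simp⟩
  have hfail : ∃ J ∈ 𝓙', ∀ f ∈ H, ∃ t ∈ T, f • t ∈ J := by
    by_contra hcon
    push Not at hcon
    have hNI : NI H T 𝓙' := by
      refine ⟨?_, ?_, ?_, fun J hJ => hsub (h.base J hJ), hcon⟩
      · rintro A B hAB ⟨J0, hJ0, s, hs, hsH, hB⟩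
        exact ⟨J0, hJ0, s, hs, hsH, hAB.trans hB⟩
      · rintro A ⟨J0, hJ0, s, hs, hsH, hA⟩ B ⟨J1, hJ1, s', hs', hsH', hB⟩
        refine ⟨_, h.union _ hJ0 _ hJ1, s ∪ s', hs.union hs', Set.union_subset hsH hsH', ?_⟩
        rw [Set.biUnion_union]
        rintro v (hv | hv)
        · rcases hA hv with hv | hv
          · exact Or.inl (Or.inl hv)
          · exact Or.inr (Or.inl hv)
        · rcases hB hv with hv | hv
          · exact Or.inl (Or.inr hv)
          · exact Or.inr (Or.inr hv)
      · rintro g hg A ⟨J0, hJ0, s, hs, hsH, hA⟩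
        refine ⟨g • J0, h.inv g hg _ hJ0, (fun x => g * x) '' s, hs.image _, ?_, ?_⟩
        · rintro _ ⟨x, hx, rfl⟩
          exact H.mul_mem hg (hsH hx)
        · rintro _ ⟨v, hv, rfl⟩
          rcases hA hv with hv | hv
          · exact Or.inl (Set.smul_mem_smul_set hv)
          · right
            obtain ⟨x, hx, hv⟩ := Set.mem_iUnion₂.1 hv
            refine Set.mem_iUnion₂.2 ⟨g * x, ⟨x, hx, rfl⟩, ?_⟩
            rw [mul_smul]
            exact Set.smul_mem_smul_set hv
    exact hWJ (hmax.le_of_ge hNI hsub hW')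
  obtain ⟨J, ⟨J0, hJ0, s, hs, hsH, hJ⟩, hall⟩ := hfail
  -- a sequence of translates with distinct separators
  have hsymm : Std.Symm (fun f f' : G ≃g G =>
      ∀ g ∈ s, ∀ g' ∈ s, f • g • L ≠ f' • g' • L ∧ f' • g • L ≠ f • g' • L) :=
    ⟨fun a b hab g hg g' hg' => (hab g hg g' hg').symm⟩
  obtain ⟨hh, hh1, hh2⟩ := exists_seq_of_forall_finset_exists'
    (fun f : G ≃g G => f ∈ H)
    (fun f f' => ∀ g ∈ s, ∀ g' ∈ s, f • g • L ≠ f' • g' • L ∧ f' • g • L ≠ f • g' • L) (by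
      intro E hE
      obtain ⟨f, hf⟩ := neumann (K := H) (X := Set V)
        (s := (fun p : ((G ≃g G) × (G ≃g G) × (G ≃g G)) => (p.2.1 • L, p.1 • p.2.2 • L)) ''
          ((E : Set (G ≃g G)) ×ˢ s ×ˢ s))
        ((E.finite_toSet.prod (hs.prod hs)).image _) (by
          rintro _ ⟨⟨e, g, g'⟩, ⟨_, hg, _⟩, rfl⟩
          have := MulAction.orbit_smul (⟨g, hsH hg⟩ : H) L
          change MulAction.orbit H (g • L) = _ at this
          simp only [this]
          exact orbit_set_infinite hL hl ho)
      refine ⟨f, f.2, fun e he g hg g' hg' => ⟨?_, ?_⟩⟩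
      · intro heq
        exact hf (g' • L, e • g • L) ⟨(e, g', g), ⟨he, hg', hg⟩, rfl⟩ heq.symm
      · intro heq
        exact hf (g • L, e • g' • L) ⟨(e, g, g'), ⟨he, hg, hg'⟩, rfl⟩ heq)
  set N := T.ncard + 1 with hN
  have hJs1 : (⋃ a ∈ Set.Iio N, hh a • J0) ∈ 𝓙 :=
    h.biUnion (Set.finite_Iio N) fun a _ => h.inv _ (hh1 a) _ hJ0
  have hJs2 : (⋃ p ∈ {p : (ℕ × ℕ) × (G ≃g G) × (G ≃g G) | p.1.1 < N ∧ p.1.2 < N ∧ p.1.1 ≠ p.1.2 ∧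
      p.2.1 ∈ s ∧ p.2.2 ∈ s}, hh p.1.1 • p.2.1 • W ∩ hh p.1.2 • p.2.2 • W) ∈ 𝓙 := by
    refine h.biUnion ?_ ?_
    · refine (((Set.finite_Iio N).prod (Set.finite_Iio N)).prod (hs.prod hs)).subset ?_
      rintro ⟨⟨a, b⟩, g, g'⟩ ⟨h1, h2, _, h3, h4⟩
      exact ⟨⟨h1, h2⟩, h3, h4⟩
    · rintro ⟨⟨a, b⟩, g, g'⟩ ⟨h1, h2, hne, h3, h4⟩
      simp only at *
      rw [← mul_smul, ← mul_smul]
      refine hB1 _ (H.mul_mem (hh1 a) (hsH h3)) _ (H.mul_mem (hh1 b) (hsH h4)) ?_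
      rw [mul_smul, mul_smul]
      exact (hh2 hne g h3 g' h4).1
  obtain ⟨f, hf, hfT⟩ := h.proper _ (h.union _ hJs1 _ hJs2)
  have hpick : ∀ a : ℕ, ∃ t ∈ T, a < N → ∃ g ∈ s, f • t ∈ hh a • g • W := by
    intro a
    obtain ⟨t, ht, hft⟩ := hall ((hh a)⁻¹ * f) (H.mul_mem (H.inv_mem (hh1 a)) hf)
    refine ⟨t, ht, fun haN => ?_⟩
    rw [mul_smul] at hft
    rcases hJ hft with h1 | h1
    · exfalso
      apply hfT t ht
      left
      exact Set.mem_iUnion₂.2 ⟨a, haN, Set.mem_smul_set_iff_inv_smul_mem.2 h1⟩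
    · obtain ⟨g, hg, h1⟩ := Set.mem_iUnion₂.1 h1
      exact ⟨g, hg, Set.mem_smul_set_iff_inv_smul_mem.2 h1⟩
  choose τ hτ1 hτ2 using hpick
  obtain ⟨a, ha, b, hb, hne, heq⟩ := Set.exists_ne_map_eq_of_ncard_lt_of_maps_to
    (s := Set.Iio N) (t := T) (f := τ) (by rw [Set.ncard_Iio_nat]; omega) (fun a _ => hτ1 a) hT
  obtain ⟨g, hg, h1⟩ := hτ2 a ha
  obtain ⟨g', hg', h2⟩ := hτ2 b hb
  apply hfT (τ a) (hτ1 a)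
  right
  exact Set.mem_iUnion₂.2 ⟨((a, b), g, g'), ⟨ha, hb, hne, hg, hg'⟩, h1, heq ▸ h2⟩

/-- Outer neighbourhood of a set. -/
def nbh {V : Type} (G : SimpleGraph V) (K : Set V) : Set V := {v | v ∉ K ∧ ∃ u ∈ K, G.Adj u v}

theorem IsComp.of_nbh {S K L : Set V} (h : IsComp G S K) (hL : nbh G K = L) : IsComp G L K := by
  obtain ⟨v, hv⟩ := h.nonempty
  refine ⟨v, fun hvL => ?_, ?_⟩
  · rw [← hL] at hvL
    exact hvL.1 hv
  · have hLS : L ⊆ S := by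
      rw [← hL]
      rintro w ⟨hw, u, hu, huw⟩
      by_contra hwS
      exact hw (h.nbr hu huw hwS)
    apply Set.Subset.antisymm
    · intro w hw
      rw [h.eq_cmp hv] at hw
      exact RO.mono hLS hw
    · intro w hw
      refine RO.induct ?_ hv hw
      intro a b ha _ hab hbL
      by_contra hb
      exact hbL (by rw [← hL]; exact ⟨hb, a, ha, hab⟩)

theorem OE.lemmaN (h : OE G ω) (hc : ¬ Cardinal.continuum ≤ Cardinal.mk (G ≃g G))
    {H : Subgroup (G ≃g G)} {T : Set V} (hT : T.Finite)
    (hTo : ∀ t ∈ T, (MulAction.orbit H t).Infinite) {R : Set V} (hR : Small G ω R) :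
    ∃ f ∈ H, ∀ t ∈ T, f • t ∉ R := by
  obtain ⟨𝓙, hmax⟩ := exists_max_ni hT hTo
  have hJ := hmax.prop
  refine hJ.proper R ?_
  refine h.small_induction (Pr := fun A => A ∈ 𝓙) ?_ hR
  intro S hS B hB
  have hSJ : S ∈ 𝓙 := hJ.base S (hS.subset Set.sdiff_subset)
  let 𝒦 : Set V → Set (Set V) := fun L => {K | K ∈ 𝓙 ∧ IsComp G S K ∧ nbh G K = L}
  have hW : (⋃ L ∈ {L | L ⊆ S}, ⋃₀ 𝒦 L) ∈ 𝓙 := by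
    refine hJ.biUnion hS.finite_subsets fun L hLS => ?_
    have hLf : L.Finite := hS.subset hLS
    have hK : ∀ K ∈ 𝒦 L, K ∈ 𝓙 ∧ IsComp G L K ∧ ∀ l ∈ L, ∃ u ∈ K, G.Adj u l := by
      rintro K ⟨h1, h2, h3⟩
      refine ⟨h1, h2.of_nbh h3, fun l hl => ?_⟩
      rw [← h3] at hl
      exact hl.2
    by_cases ho : ∀ l ∈ L, (MulAction.orbit H l).Finite
    · exact ideal_caseA hJ hc hLf ho fun K hK' => ⟨(hK K hK').1, (hK K hK').2.1⟩
    · push Not at ho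
      obtain ⟨l, hl, ho⟩ := ho
      exact ideal_caseB hT hmax hLf hl ho hK
  refine hJ.down _ _ ?_ (hJ.union _ hSJ _ hW)
  intro b hb
  by_cases hbS : b ∈ S
  · exact Or.inl hbS
  right
  have hcomp := isComp_cmp (G := G) hbS
  refine Set.mem_iUnion₂.2 ⟨nbh G (cmp G S b), ?_, cmp G S b, ⟨hB b hb hbS, hcomp, rfl⟩,
    mem_cmp_self hbS⟩
  rintro w ⟨hw, u, hu, huw⟩
  by_contra hwS
  exact hw (hcomp.nbr hu huw hwS)

theorem OE.FF_finite (h : OE G ω) (hc : ¬ Cardinal.continuum ≤ Cardinal.mk (G ≃g G)) :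
    Finite (FF h) := by
  by_contra hinf
  have hinf : Infinite (FF h) := not_finite_iff_infinite.1 hinf
  obtain ⟨T, hT, hT1⟩ := h.exists_T hc
  set T₁ : Set V := {t ∈ T | (MulAction.orbit (FF h) t).Finite} with hT₁
  have hT₁f : T₁.Finite := hT.subset fun t ht => ht.1
  have hR := range_restr_finite hT₁f (H := FF h) (fun l hl => hl.2)
  let H' : Subgroup (G ≃g G) := FF h ⊓ fixingSubgroup (G ≃g G) T₁
  have hdiv : ∀ g g' : FF h, (fun l : T₁ => g • (l : V)) = (fun l : T₁ => g' • (l : V)) →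
      (g : G ≃g G)⁻¹ * g' ∈ H' := by
    intro g g' heq
    refine ⟨(FF h).mul_mem ((FF h).inv_mem g.2) g'.2, ?_⟩
    refine (mem_fixingSubgroup_iff (G ≃g G)).2 ?_
    intro t ht
    rw [mul_smul, inv_smul_eq_iff]
    exact (congrFun heq ⟨t, ht⟩).symm
  obtain ⟨g, hgH, hg1⟩ : ∃ g ∈ H', g ≠ 1 := by
    have := hR.to_subtype
    obtain ⟨g, g', hne, heq⟩ := Finite.exists_ne_map_eq_of_infinite
      (Set.rangeFactorization (fun (h : FF h) (l : T₁) => h • (l : V)))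
    refine ⟨_, hdiv g g' (congrArg Subtype.val heq), fun h1 => hne ?_⟩
    rw [inv_mul_eq_one] at h1
    exact Subtype.ext h1
  have hT₂ : ∀ t ∈ T \ T₁, (MulAction.orbit H' t).Infinite := by
    intro t ht hfin
    apply ht.2
    refine ⟨ht.1, ?_⟩
    have hch : ∀ r : T₁ → V, ∃ c : FF h, r ∈ Set.range (fun (h : FF h) (l : T₁) => h • (l : V)) →
        (fun l : T₁ => c • (l : V)) = r := by
      intro r
      by_cases hr : r ∈ Set.range (fun (h : FF h) (l : T₁) => h • (l : V))
      · obtain ⟨c, hc⟩ := hr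
        exact ⟨c, fun _ => hc⟩
      · exact ⟨1, fun h => (hr h).elim⟩
    choose c hcc using hch
    refine (hR.biUnion (t := fun r => (c r : G ≃g G) • MulAction.orbit H' t)
      (fun r _ => hfin.image _)).subset ?_
    rintro _ ⟨x, rfl⟩
    have hm : (fun l : T₁ => x • (l : V)) ∈ Set.range (fun (h : FF h) (l : T₁) => h • (l : V)) :=
      ⟨x, rfl⟩
    refine Set.mem_iUnion₂.2 ⟨_, hm, ?_⟩
    rw [Set.mem_smul_set_iff_inv_smul_mem]
    refine ⟨⟨_, hdiv _ x (hcc _ hm)⟩, ?_⟩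
    exact mul_smul ((c (fun l : T₁ => x • (l : V)) : G ≃g G)⁻¹) (x : G ≃g G) t
  obtain ⟨f, hf, hfT⟩ := h.lemmaN hc (hT.subset Set.sdiff_subset) hT₂ (R := supp g) hgH.1
  have hfix : ∀ x ∈ H', ∀ t ∈ T₁, x • t = t := fun x hx t ht =>
    (mem_fixingSubgroup_iff _).1 hx.2 t ht
  have h1 := hT1 (f⁻¹ * g * f) ((FF h).mul_mem ((FF h).mul_mem ((FF h).inv_mem hf.1) hgH.1) hf.1) (by
    intro t ht
    rw [mul_smul, mul_smul, inv_smul_eq_iff]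
    by_cases ht1 : t ∈ T₁
    · rw [hfix f hf t ht1, hfix g hgH t ht1]
    · exact not_mem_supp.1 (hfT t ⟨ht, ht1⟩))
  apply hg1
  have h2 : g = f * (f⁻¹ * g * f) * f⁻¹ := by group
  rw [h2, h1]; group

end P4


section Cuts
open scoped Pointwise
variable {V : Type} {G : SimpleGraph V} {ω : ℕ → V} {κ : ℕ} {Z₀ : Set V}

/-- `Z` is linked to the end by `κ` many paths (in the Menger-dual form). -/
def Lk {V : Type} (G : SimpleGraph V) (ω : ℕ → V) (κ : ℕ) (Z : Set V) : Prop :=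
  ∀ A, Small G ω A → Z ⊆ A → (κ : ℕ∞) ≤ (bd G A).encard

theorem Lk.mono {Z Z' : Set V} (h : Lk G ω κ Z) (hs : Z ⊆ Z') : Lk G ω κ Z' :=
  fun A hA hZ => h A hA (hs.trans hZ)

theorem encard_smul' (g : G ≃g G) (A : Set V) : (g • A).encard = A.encard :=
  (MulAction.injective g).encard_image A

theorem Lk.smul (h : OE G ω) (g : G ≃g G) {Z : Set V} (hZ : Lk G ω κ Z) : Lk G ω κ (g • Z) := by
  intro A hA hs
  have := hZ (g⁻¹ • A) (h.small_smul _ hA) (by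
    rw [Set.smul_set_subset_iff_subset_inv_smul_set] at hs; exact hs)
  rwa [bd_smul, encard_smul'] at this

/-- A small set with a boundary of minimal size. -/
structure Pre {V : Type} (G : SimpleGraph V) (ω : ℕ → V) (κ : ℕ) (E : Set V) : Prop where
  small : Small G ω E
  le : (bd G E).encard ≤ κ
  lk : Lk G ω κ E

/-- A precut whose complement is the component of the end. -/
structure Cut {V : Type} (G : SimpleGraph V) (ω : ℕ → V) (κ : ℕ) (E : Set V) : Prop
    extends Pre G ω κ E where
  co : Eᶜ ⊆ C G ω (bd G E)

/-- The setup. -/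
structure Ctx {V : Type} (G : SimpleGraph V) (ω : ℕ → V) (κ : ℕ) (Z₀ : Set V) : Prop where
  oe : OE G ω
  bdd : Bdd G ω κ
  fin : Z₀.Finite
  lk : Lk G ω κ Z₀

theorem OE.exists_ctx (h : OE G ω) (hb : ∃ κ, Bdd G ω κ) : ∃ κ Z₀, Ctx G ω κ Z₀ := by
  classical
  refine ⟨Nat.find hb, ?_⟩
  have hm := fun m => Nat.find_min hb (m := m)
  have hs := Nat.find_spec hb
  generalize Nat.find hb = κ at hm hs
  rcases κ with _ | n
  · exact ⟨∅, h, hs, Set.finite_empty, fun A _ _ => by simp⟩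
  · have := hm n (Nat.lt_succ_self n)
    unfold Bdd at this
    push Not at this
    obtain ⟨Z, hZ, hZ'⟩ := this
    refine ⟨Z, h, hs, hZ, fun A hA hs => ?_⟩
    have := hZ' A hA hs
    have := Order.add_one_le_of_lt this
    exact_mod_cast this

theorem Pre.fin {E : Set V} (hE : Pre G ω κ E) : (bd G E).Finite :=
  Set.encard_lt_top_iff.1 (hE.le.trans_lt (ENat.natCast_lt_top κ))

theorem Pre.disj (h : OE G ω) {E : Set V} (hE : Pre G ω κ E) : Disjoint (C G ω (bd G E)) E :=
  h.dich_small hE.small hE.fin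

theorem Pre.eq {E : Set V} (hE : Pre G ω κ E) : (bd G E).encard = κ :=
  hE.le.antisymm (hE.lk E hE.small subset_rfl)

theorem Pre.smul (h : OE G ω) (g : G ≃g G) {E : Set V} (hE : Pre G ω κ E) : Pre G ω κ (g • E) :=
  ⟨h.small_smul g hE.small, by rw [bd_smul, encard_smul']; exact hE.le, hE.lk.smul h g⟩

theorem Cut.smul (h : OE G ω) (g : G ≃g G) {E : Set V} (hE : Cut G ω κ E) : Cut G ω κ (g • E) :=
  ⟨hE.toPre.smul h g, by
    rw [bd_smul, ← h.C_smul g _ hE.fin, ← Set.smul_set_compl]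
    exact Set.smul_set_mono hE.co⟩

theorem Cut.co_eq (h : OE G ω) {E : Set V} (hE : Cut G ω κ E) : Eᶜ = C G ω (bd G E) :=
  hE.co.antisymm (hE.disj h).subset_compl_right

/-- Fill up a precut. -/
def fill {V : Type} (G : SimpleGraph V) (ω : ℕ → V) (E : Set V) : Set V := (C G ω (bd G E))ᶜ

theorem Pre.sub_fill (h : OE G ω) {E : Set V} (hE : Pre G ω κ E) : E ⊆ fill G ω E :=
  (hE.disj h).subset_compl_left

theorem Pre.bd_fill (h : OE G ω) {E : Set V} (hE : Pre G ω κ E) :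
    bd G (fill G ω E) = bd G E := by
  have hsub : bd G (fill G ω E) ⊆ bd G E := by
    rintro v ⟨hv, w, hw, hvw⟩
    by_contra hvE
    have hw : w ∈ C G ω (bd G E) := not_not.1 hw
    exact hv (C_closed hw (RO.adj hvw.symm (Set.disjoint_left.1 C_disj hw) hvE))
  refine Set.Finite.eq_of_subset_of_encard_le (hE.fin.subset hsub) hsub ?_
  rw [hE.eq]
  exact hE.lk _ (h.small_compl_C hE.fin) (hE.sub_fill h)

theorem Pre.fill (h : OE G ω) {E : Set V} (hE : Pre G ω κ E) : Cut G ω κ (fill G ω E) :=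
  ⟨⟨h.small_compl_C hE.fin, by rw [hE.bd_fill h]; exact hE.le, hE.lk.mono (hE.sub_fill h)⟩, by
    rw [hE.bd_fill h, PaperEnds.fill, compl_compl]⟩

theorem Pre.fill_sub (h : OE G ω) {E A : Set V} (hE : Pre G ω κ E) (hA : Cut G ω κ A)
    (hs : E ⊆ A) : PaperEnds.fill G ω E ⊆ A := by
  rw [PaperEnds.fill, Set.compl_subset_comm, hA.co_eq h]
  refine h.C_sub hA.fin hE.fin ?_
  exact ((hA.disj h).mono_right (bd_sub.trans hs)).symm

theorem Pre.adj (h : OE G ω) {E : Set V} (hE : Pre G ω κ E) {v : V} (hv : v ∈ bd G E) :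
    ∃ w ∈ C G ω (bd G E), G.Adj v w := by
  rw [← hE.bd_fill h] at hv
  obtain ⟨_, w, hw, hvw⟩ := hv
  exact ⟨w, not_not.1 hw, hvw⟩

theorem fill_smul (h : OE G ω) (g : G ≃g G) {E : Set V} (hE : Pre G ω κ E) :
    fill G ω (g • E) = g • fill G ω E := by
  rw [fill, fill, bd_smul, ← h.C_smul g _ hE.fin, Set.smul_set_compl]

theorem Ctx.exists_cut (c : Ctx G ω κ Z₀) {B : Set V} (hB : Small G ω B) :
    ∃ A, Cut G ω κ A ∧ B ⊆ A := by
  obtain ⟨X, hX, hd⟩ := hB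
  obtain ⟨E, hE, hZE, hle⟩ := c.bdd (X ∪ Z₀) (hX.union c.fin)
  have hP : Pre G ω κ E := ⟨hE, hle, c.lk.mono (Set.subset_union_right.trans hZE)⟩
  refine ⟨_, hP.fill c.oe, ?_⟩
  have : C G ω (bd G E) ⊆ C G ω X := by
    refine c.oe.C_sub hP.fin hX ?_
    exact ((hP.disj c.oe).mono_right (Set.subset_union_left.trans hZE)).symm
  exact (hd.mono_left this).subset_compl_left

theorem Pre.inter_le {A A' : Set V} (hA : Pre G ω κ A) (hA' : Pre G ω κ A') :
    (bd G (A ∩ A')).encard ≤ κ := by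
  have h1 := bd_submod (G := G) A A' ∅
  simp only [Set.sdiff_empty] at h1
  rw [hA.eq, hA'.eq, add_comm] at h1
  exact enat_aux h1 (hA.lk _ (hA.small.union hA'.small) Set.subset_union_left)

theorem Pre.union {A A' : Set V} (hA : Pre G ω κ A) (hA' : Pre G ω κ A')
    (hl : Lk G ω κ (A ∩ A')) : Pre G ω κ (A ∪ A') := by
  refine ⟨hA.small.union hA'.small, ?_, hA.lk.mono Set.subset_union_left⟩
  have h1 := bd_submod (G := G) A A' ∅
  simp only [Set.sdiff_empty] at h1
  rw [hA.eq, hA'.eq] at h1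
  exact enat_aux h1 (hl _ (hA.small.mono Set.inter_subset_left) subset_rfl)

theorem Cut.inter (h : OE G ω) {A A' : Set V} (hA : Cut G ω κ A) (hA' : Cut G ω κ A')
    (hl : Lk G ω κ (A ∩ A')) : Cut G ω κ (A ∩ A') := by
  have hP : Pre G ω κ (A ∩ A') :=
    ⟨hA.small.mono Set.inter_subset_left, hA.toPre.inter_le hA'.toPre, hl⟩
  refine ⟨hP, ?_⟩
  rw [Set.compl_inter, hA.co_eq h, hA'.co_eq h]
  refine Set.union_subset (h.C_sub hA.fin hP.fin ?_) (h.C_sub hA'.fin hP.fin ?_)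
  · exact ((hA.disj h).mono_right (bd_sub.trans Set.inter_subset_left)).symm
  · exact ((hA'.disj h).mono_right (bd_sub.trans Set.inter_subset_right)).symm

theorem Cut.ext_bd (h : OE G ω) {A A' : Set V} (hA : Cut G ω κ A) (hA' : Cut G ω κ A')
    (hb : bd G A = bd G A') : A = A' := by
  rw [← compl_inj_iff, hA.co_eq h, hA'.co_eq h, hb]

theorem OE.crit (h : OE G ω) {A : Set V} (hA : Small G ω A) : ∀ U ⊆ A, U.Infinite →
    ∃ L : Set V, L.Finite ∧ ((fun u => cmp G L u) '' (U \ L)).Infinite := by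
  refine h.small_induction (Pr := fun A => ∀ U ⊆ A, U.Infinite →
    ∃ L : Set V, L.Finite ∧ ((fun u => cmp G L u) '' (U \ L)).Infinite) ?_ hA
  intro S hS B hB U hU hUi
  by_cases hf : ((fun u => cmp G S u) '' (U \ S)).Finite
  · have hUS : (U \ S).Infinite := hUi.sdiff hS
    obtain ⟨K, ⟨u, hu, rfl⟩, hK⟩ : ∃ K ∈ (fun u => cmp G S u) '' (U \ S),
        {v ∈ U \ S | cmp G S v = K}.Infinite := by
      by_contra hcon
      push Not at hcon
      refine hUS ((hf.biUnion (t := fun K => {v ∈ U \ S | cmp G S v = K})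
        (fun K hK => hcon K hK)).subset ?_)
      intro v hv
      exact Set.mem_iUnion₂.2 ⟨_, ⟨v, hv, rfl⟩, hv, rfl⟩
    obtain ⟨L, hL, hLi⟩ := hB u (hU hu.1) hu.2 {v ∈ U \ S | cmp G S v = cmp G S u} (by
      rintro v ⟨hv, hve⟩
      rw [← hve]
      exact RO.refl hv.2) hK
    refine ⟨L, hL, hLi.mono (Set.image_mono ?_)⟩
    exact fun v hv => ⟨hv.1.1.1, hv.2⟩
  · exact ⟨S, hS, hf⟩

theorem OE.dcc (h : OE G ω) {A : ℕ → Set V} (hA : ∀ m, Cut G ω κ (A m))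
    (hs : ∀ m, A (m + 1) ⊂ A m) : False := by
  have hanti : StrictAnti A := strictAnti_nat_of_succ_lt hs
  have hUi : (⋃ m, bd G (A m)).Infinite := by
    intro hfin
    have hinj : Function.Injective fun m => bd G (A m) := fun m n hmn =>
      hanti.injective ((hA m).ext_bd h (hA n) hmn)
    refine Set.infinite_range_of_injective hinj (hfin.finite_subsets.subset ?_)
    rintro _ ⟨m, rfl⟩
    exact Set.subset_iUnion (fun m => bd G (A m)) m
  obtain ⟨L, hL, hLi⟩ := h.crit (hA 0).small (⋃ m, bd G (A m))
    (Set.iUnion_subset fun m => bd_sub.trans (hanti.antitone (Nat.zero_le m))) hUi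
  obtain ⟨m0, hm0⟩ : ∃ m0, ∀ m, m0 ≤ m → L ∩ A m = L ∩ A m0 := by
    obtain ⟨m0, hm0⟩ := exists_minimal_of_wellFoundedLT (fun n => n ∈ Set.range fun m => (L ∩ A m).ncard)
      ⟨_, ⟨0, rfl⟩⟩
    obtain ⟨⟨m0, rfl⟩, hmin⟩ := hm0
    refine ⟨m0, fun m hm => ?_⟩
    have hsub : L ∩ A m ⊆ L ∩ A m0 := Set.inter_subset_inter_right _ (hanti.antitone hm)
    refine Set.eq_of_subset_of_ncard_le hsub ?_ (hL.inter_of_left _)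
    exact hmin ⟨m, rfl⟩ (Set.ncard_le_ncard hsub (hL.inter_of_left _))
  obtain ⟨K, ⟨u, ⟨huU, huL⟩, rfl⟩, hK⟩ :
      ∃ K ∈ (fun u => cmp G L u) '' ((⋃ m, bd G (A m)) \ L),
        K ∉ (fun u => cmp G L u) '' (⋃ m ∈ Set.Iic m0, bd G (A m)) := by
    have := (hLi.sdiff (((Set.finite_Iic m0).biUnion (fun m _ => (hA m).fin)).image
      (fun u => cmp G L u))).nonempty
    obtain ⟨K, hK⟩ := this
    exact ⟨K, hK.1, hK.2⟩
  have hKX : ∀ m ≤ m0, ∀ v, RO G L u v → v ∉ bd G (A m) := by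
    intro m hm v hv hvb
    exact hK ⟨v, Set.mem_iUnion₂.2 ⟨m, hm, hvb⟩, (cmp_eq hv).symm⟩
  obtain ⟨m, hum⟩ := Set.mem_iUnion.1 huU
  have hm : m0 < m := by
    by_contra hlt
    exact hKX m (not_lt.1 hlt) u (.refl huL) hum
  have hKA : ∀ v, RO G L u v → v ∈ A m0 := by
    intro v hv
    have : v ∈ {v | RO G L u v ∧ v ∈ A m0} := by
      refine RO.induct ?_ ⟨.refl huL, hanti.antitone hm.le (bd_sub hum)⟩ hv
      rintro a b ⟨ha, ha'⟩ _ hab hb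
      refine ⟨ha.step hab hb, ?_⟩
      by_contra hbA
      exact hKX m0 le_rfl a ha ⟨ha', b, hbA, hab⟩
    exact this.2
  -- crossing edges lead to a contradiction
  have hcross : ∀ a b, RO G L u a → G.Adj a b → b ∉ A m → RO G L u b := by
    intro a b ha hab hb
    by_contra hbK
    have hbL : b ∈ L := by
      by_contra hbL
      exact hbK (ha.step hab hbL)
    have : b ∉ A m0 := by
      intro hbA
      have : b ∈ L ∩ A m := by rw [hm0 m hm.le]; exact ⟨hbL, hbA⟩
      exact hb this.2
    exact hKX m0 le_rfl a ha ⟨hKA a ha, b, this, hab⟩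
  obtain ⟨_, w, hw, huw⟩ := hum
  have hwK := hcross u w (.refl huL) huw hw
  obtain ⟨x, hx⟩ := h.C_nonempty (hA m0).fin
  have hx0 : x ∉ A m0 := Set.disjoint_left.1 ((hA m0).disj h) hx
  have hxm : x ∈ C G ω (bd G (A m)) := (hA m).co fun hxA => hx0 (hanti.antitone hm.le hxA)
  have hwx := h.C_conn ((hA m).co hw) hxm
  have : x ∈ {v | RO G L u v ∧ v ∈ C G ω (bd G (A m))} := by
    refine RO.induct ?_ ⟨hwK, (hA m).co hw⟩ hwx
    rintro a b ⟨ha, ha'⟩ h1 hab hb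
    have hbC := C_closed ha' (RO.adj hab h1 hb)
    exact ⟨hcross a b ha hab (Set.disjoint_left.1 ((hA m).disj h) hbC), hbC⟩
  exact hx0 (hKA x this.1)

theorem OE.exists_min (h : OE G ω) (κ : ℕ) {P : Set V → Prop} (hP : ∃ A, Cut G ω κ A ∧ P A) :
    ∃ A, Cut G ω κ A ∧ P A ∧ ∀ A', Cut G ω κ A' → P A' → A' ⊆ A → A' = A := by
  by_contra hcon
  push Not at hcon
  have hstep : ∀ A : {A // Cut G ω κ A ∧ P A}, ∃ A' : {A // Cut G ω κ A ∧ P A}, A'.1 ⊂ A.1 := by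
    rintro ⟨A, hA, hPA⟩
    obtain ⟨A', h1, h2, h3, h4⟩ := hcon A hA hPA
    exact ⟨⟨A', h1, h2⟩, h3.ssubset_of_ne h4⟩
  choose f hf using hstep
  obtain ⟨A, hA⟩ := hP
  exact h.dcc (A := fun n => (f^[n] ⟨A, hA⟩).1) (fun m => (f^[m] ⟨A, hA⟩).2.1) (fun m => by
    rw [Function.iterate_succ_apply']
    exact hf _)

theorem Cut.smul_eq (h : OE G ω) (g : G ≃g G) {W : Set V} (hW : Cut G ω κ W) (hs : g • W ⊆ W) :
    g • W = W := by
  by_contra hne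
  refine h.dcc (A := fun n => g ^ n • W) (fun m => hW.smul h _) (fun m => ?_)
  rw [pow_succ, mul_smul]
  exact ⟨Set.smul_set_mono hs, fun h' => hne (hs.antisymm (Set.smul_set_subset_smul_set_iff.1 h'))⟩

end Cuts


section Fixing
open scoped Pointwise
variable {V : Type} {G : SimpleGraph V} {ω : ℕ → V} {κ : ℕ} {Z₀ : Set V}

theorem Cut.sub_of_bd (h : OE G ω) {A M : Set V} (hA : Cut G ω κ A) (hM : Cut G ω κ M)
    (hs : bd G A ⊆ M) : A ⊆ M := by
  rw [← Set.compl_subset_compl, hM.co_eq h, hA.co_eq h]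
  exact h.C_sub hM.fin hA.fin ((hM.disj h).mono_right hs).symm

theorem Ctx.fix_of_small (c : Ctx G ω κ Z₀) {N : Set V} (hN : Small G ω N) (hl : Lk G ω κ N)
    {S : Set (G ≃g G)} (hS : ∀ s ∈ S, s • N ⊆ N) :
    ∃ W, Cut G ω κ W ∧ N ⊆ W ∧ ∀ s ∈ S, s • W = W := by
  obtain ⟨W, hW, hNW, hmin⟩ := c.oe.exists_min κ (c.exists_cut hN)
  refine ⟨W, hW, hNW, fun s hs => hW.smul_eq c.oe s ?_⟩
  have hN' : N ⊆ W ∩ s⁻¹ • W := by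
    refine Set.subset_inter hNW ?_
    rw [← Set.smul_set_subset_iff_subset_inv_smul_set]
    exact (hS s hs).trans hNW
  have := hmin _ (hW.inter c.oe (hW.smul c.oe s⁻¹) (hl.mono hN')) hN' Set.inter_subset_left
  rw [Set.smul_set_subset_iff_subset_inv_smul_set]
  exact Set.inter_eq_left.1 this

theorem dir_key (h : OE G ω) {𝒢 : Set (Set V)} (hne : 𝒢.Nonempty)
    (hd : ∀ A ∈ 𝒢, ∀ B ∈ 𝒢, ∃ D ∈ 𝒢, A ⊆ D ∧ B ⊆ D) (hP : ∀ E ∈ 𝒢, Pre G ω κ E) :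
    (bd G (⋃₀ 𝒢)).Finite ∧ ∃ E ∈ 𝒢, C G ω (bd G E) ⊆ C G ω (bd G (⋃₀ 𝒢)) := by
  have h1 : (bd G (⋃₀ 𝒢) \ ∅).encard ≤ κ := bd_sUnion_le hne hd fun A hA => by
    rw [Set.sdiff_empty]; exact (hP A hA).le
  rw [Set.sdiff_empty] at h1
  have hf : (bd G (⋃₀ 𝒢)).Finite := Set.encard_lt_top_iff.1 (h1.trans_lt (ENat.natCast_lt_top κ))
  obtain ⟨E, hE, hsub⟩ := finite_sub_directed hne hd hf bd_sub
  exact ⟨hf, E, hE, h.C_sub (hP E hE).fin hf (((hP E hE).disj h).mono_right hsub).symm⟩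

theorem key_out {E Y : Set V} (hE : Pre G ω κ E) (hY : Pre G ω κ Y) (hl : Lk G ω κ (E ∩ Y))
    {u : V} (hu : u ∈ bd G Y) (huE : u ∉ E) : u ∈ bd G (E ∪ Y) := by
  by_contra hcon
  rw [Set.union_comm] at hcon
  have h1 := bd_submod_strict hY.fin hE.fin hu huE hcon
  rw [hE.eq, hY.eq] at h1
  have h2 := hE.lk _ (hY.small.union hE.small) Set.subset_union_right
  rw [Set.inter_comm] at hl
  have h3 := hl _ (hY.small.mono Set.inter_subset_left) subset_rfl
  exact absurd h1 (not_lt.2 (add_le_add h2 h3))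

theorem key_C (h : OE G ω) {E F : Set V} (hE : Pre G ω κ E) (hF : Pre G ω κ F) (hEF : E ⊆ F)
    {u : V} (hu : u ∈ bd G F) (huE : u ∉ E) : u ∈ C G ω (bd G E) := by
  obtain ⟨w, hw, huw⟩ := hF.adj h hu
  have hs : C G ω (bd G F) ⊆ C G ω (bd G E) :=
    h.C_sub hF.fin hE.fin ((hF.disj h).mono_right (bd_sub.trans hEF)).symm
  exact C_closed (hs hw) (RO.adj huw.symm (Set.disjoint_left.1 C_disj (hs hw))
    fun hb => huE (bd_sub hb))

/-- Finite unions of translates. -/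
def Un {V : Type} {G : SimpleGraph V} (g : G ≃g G) (A : Set V) (n : ℕ) : Set V :=
  {v | ∃ j ≤ n, v ∈ g ^ j • A}

theorem Un_zero (g : G ≃g G) (A : Set V) : Un g A 0 = A := by
  ext v
  constructor
  · rintro ⟨j, hj, hv⟩
    obtain rfl : j = 0 := by omega
    rwa [pow_zero, one_smul] at hv
  · intro hv
    exact ⟨0, le_rfl, by rwa [pow_zero, one_smul]⟩

theorem Un_succ (g : G ≃g G) (A : Set V) (n : ℕ) : Un g A (n + 1) = Un g A n ∪ g ^ (n + 1) • A := by
  ext v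
  constructor
  · rintro ⟨j, hj, hv⟩
    rcases Nat.lt_or_ge j (n + 1) with hlt | hge
    · exact Or.inl ⟨j, by omega, hv⟩
    · obtain rfl : j = n + 1 := by omega
      exact Or.inr hv
  · rintro (⟨j, hj, hv⟩ | hv)
    · exact ⟨j, by omega, hv⟩
    · exact ⟨n + 1, le_rfl, hv⟩

theorem Un_mono (g : G ≃g G) (A : Set V) {m n : ℕ} (h : m ≤ n) : Un g A m ⊆ Un g A n := by
  rintro v ⟨j, hj, hv⟩
  exact ⟨j, hj.trans h, hv⟩

theorem Un_dir (g : G ≃g G) (A : Set V) : ∀ E ∈ Set.range (Un g A), ∀ F ∈ Set.range (Un g A),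
    ∃ D ∈ Set.range (Un g A), E ⊆ D ∧ F ⊆ D := by
  rintro _ ⟨m, rfl⟩ _ ⟨n, rfl⟩
  exact ⟨_, ⟨max m n, rfl⟩, Un_mono g A (le_max_left _ _), Un_mono g A (le_max_right _ _)⟩

theorem Ctx.pre_Un (c : Ctx G ω κ Z₀) (g : G ≃g G) {A : Set V} (hA : Cut G ω κ A) (h1 : Z₀ ⊆ A)
    (h2 : g • Z₀ ⊆ A) (n : ℕ) : Pre G ω κ (Un g A n) := by
  induction n with
  | zero => rw [Un_zero]; exact hA.toPre
  | succ n ih =>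
    rw [Un_succ]
    refine ih.union (hA.toPre.smul c.oe _) ((c.lk.smul c.oe (g ^ (n + 1))).mono ?_)
    refine Set.subset_inter ?_ (Set.smul_set_mono h1)
    intro v hv
    refine ⟨n, le_rfl, ?_⟩
    rw [pow_succ, mul_smul] at hv
    exact Set.smul_set_mono h2 hv

theorem Ctx.step4 (c : Ctx G ω κ Z₀) (g : G ≃g G) {B : Set V} (hB : Small G ω B) :
    ∃ A, Cut G ω κ A ∧ B ⊆ A ∧ g • A = A := by
  have hZs : Small G ω Z₀ := small_finite c.fin
  obtain ⟨A, hA, hBA⟩ := c.exists_cut ((hB.union hZs).union (c.oe.small_smul g hZs))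
  have hB' : B ⊆ A := (Set.subset_union_left.trans Set.subset_union_left).trans hBA
  have hZ1 : Z₀ ⊆ A := (Set.subset_union_right.trans Set.subset_union_left).trans hBA
  have hZ2 : g • Z₀ ⊆ A := Set.subset_union_right.trans hBA
  have hAU : A ⊆ ⋃₀ Set.range (Un g A) := Set.subset_sUnion_of_mem ⟨0, Un_zero g A⟩
  obtain ⟨hfin, -⟩ := dir_key c.oe (Set.range_nonempty (Un g A)) (Un_dir g A) (κ := κ) (by
    rintro _ ⟨n, rfl⟩
    exact c.pre_Un g hA hZ1 hZ2 n)
  rcases c.oe.dich (⋃₀ Set.range (Un g A)) with hd | hd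
  · obtain ⟨A', hA', hs⟩ := c.exists_cut (hA.small.union (c.oe.small_compl_C hfin))
    have hAA' : A ⊆ A' := Set.subset_union_left.trans hs
    have hall : ∀ v, v ∈ ⋃₀ Set.range (Un g A') := by
      intro v
      by_cases hv : v ∈ C G ω (bd G (⋃₀ Set.range (Un g A)))
      · obtain ⟨_, ⟨n, rfl⟩, j, hj, hvj⟩ := hd hv
        exact ⟨_, ⟨n, rfl⟩, j, hj, Set.smul_set_mono hAA' hvj⟩
      · exact ⟨_, ⟨0, rfl⟩, by rw [Un_zero]; exact hs (Or.inr hv)⟩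
    obtain ⟨_, ⟨n, rfl⟩, hn⟩ := finite_sub_directed (t := g⁻¹ • bd G A') (Set.range_nonempty (Un g A')) (Un_dir g A')
      (hA'.fin.image _) (fun v _ => hall v)
    have hE := c.pre_Un g hA' (hZ1.trans hAA') (hZ2.trans hAA') n
    have hM := hE.fill c.oe
    have h1 : A' ⊆ g • fill G ω (Un g A' n) := by
      refine hA'.sub_of_bd c.oe (hM.smul c.oe g) ?_
      rw [Set.smul_set_subset_iff_subset_inv_smul_set, inv_inv] at hn
      exact hn.trans (Set.smul_set_mono (hE.sub_fill c.oe))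
    have h2 : fill G ω (Un g A' n) ⊆ g • fill G ω (Un g A' n) := by
      refine hE.fill_sub c.oe (hM.smul c.oe g) ?_
      rintro v ⟨j, hj, hv⟩
      rcases j with _ | j
      · rw [pow_zero, one_smul] at hv
        exact h1 hv
      · rw [pow_succ', mul_smul] at hv
        obtain ⟨w, hw, rfl⟩ := hv
        exact Set.smul_mem_smul_set (hE.sub_fill c.oe ⟨j, by omega, hw⟩)
    have h3 := hM.smul_eq c.oe g⁻¹ (by
      rw [Set.smul_set_subset_iff_subset_inv_smul_set, inv_inv]; exact h2)
    have h4 : g • fill G ω (Un g A' n) = fill G ω (Un g A' n) := by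
      rw [inv_smul_eq_iff] at h3; exact h3.symm
    exact ⟨_, hM, (hB'.trans hAA').trans (h1.trans h4.subset), h4⟩
  · have hU : Small G ω (⋃₀ Set.range (Un g A)) := ⟨_, hfin, hd⟩
    obtain ⟨W, hW, hUW, hfix⟩ := c.fix_of_small hU (hA.lk.mono hAU) (S := {g}) (by
      rintro _ rfl
      rintro _ ⟨v, ⟨_, ⟨n, rfl⟩, j, hj, hv⟩, rfl⟩
      refine ⟨_, ⟨n + 1, rfl⟩, j + 1, by omega, ?_⟩
      rw [pow_succ', mul_smul]
      exact Set.smul_mem_smul_set hv)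
    exact ⟨W, hW, hB'.trans (hAU.trans hUW), hfix g rfl⟩

/-- The union of the boundaries of cuts beyond `P`. -/
def Q {V : Type} (G : SimpleGraph V) (ω : ℕ → V) (κ : ℕ) (P : Set V) : Set V :=
  {v | ∃ Y, Cut G ω κ Y ∧ P ⊆ Y ∧ v ∈ bd G Y}

theorem Q_anti {P P' : Set V} (h : P ⊆ P') : Q G ω κ P' ⊆ Q G ω κ P := by
  rintro v ⟨Y, hY, hP, hv⟩
  exact ⟨Y, hY, h.trans hP, hv⟩

theorem Q_smul_sub (h : OE G ω) (g : G ≃g G) (P : Set V) : g • Q G ω κ P ⊆ Q G ω κ (g • P) := by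
  rintro _ ⟨v, ⟨Y, hY, hP, hv⟩, rfl⟩
  refine ⟨g • Y, hY.smul h g, Set.smul_set_mono hP, ?_⟩
  rw [bd_smul]
  exact Set.smul_mem_smul_set hv

theorem Q_smul (h : OE G ω) (g : G ≃g G) (P : Set V) : g • Q G ω κ P = Q G ω κ (g • P) := by
  refine (Q_smul_sub h g P).antisymm ?_
  have := Q_smul_sub h (κ := κ) g⁻¹ (g • P)
  rwa [inv_smul_smul, Set.smul_set_subset_iff_subset_inv_smul_set, inv_inv] at this

theorem Q_fin (h : OE G ω) {P : Set V} (hl : Lk G ω κ P) {A : Set V} (hA : Cut G ω κ A)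
    (hPA : P ⊆ A) : (Q G ω κ P ∩ A).Finite := by
  by_contra hcon
  obtain ⟨A, hA, ⟨hPA, hinf⟩, hmin⟩ := h.exists_min κ
    (P := fun A => P ⊆ A ∧ ¬ (Q G ω κ P ∩ A).Finite) ⟨A, hA, hPA, hcon⟩
  have hR : ((Q G ω κ P ∩ A) \ bd G A).Infinite := Set.Infinite.sdiff hinf hA.fin
  have hY : ∀ u ∈ (Q G ω κ P ∩ A) \ bd G A, ∃ Y, Cut G ω κ Y ∧ P ⊆ Y ∧ Y ⊆ A ∧ u ∈ bd G Y ∧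
      (Q G ω κ P ∩ Y).Finite := by
    rintro u ⟨⟨⟨Y, hY, hPY, huY, w, hw, huw⟩, huA⟩, hub⟩
    have hP' : P ⊆ Y ∩ A := Set.subset_inter hPY hPA
    have hcut := hY.inter h hA (hl.mono hP')
    refine ⟨Y ∩ A, hcut, hP', Set.inter_subset_right,
      ⟨⟨huY, huA⟩, w, fun hw' => hw hw'.1, huw⟩, ?_⟩
    by_contra hni
    have := hmin _ hcut ⟨hP', hni⟩ Set.inter_subset_right
    have hAY : A ⊆ Y := Set.inter_eq_right.1 this
    exact hub ⟨huA, w, fun hwA => hw (hAY hwA), huw⟩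
  let 𝒢 : Set (Set V) := {E | Pre G ω κ E ∧ P ⊆ E ∧ E ⊆ A ∧ (Q G ω κ P ∩ E).Finite}
  have hunion : ∀ E ∈ 𝒢, ∀ F ∈ 𝒢, E ∪ F ∈ 𝒢 := by
    rintro E ⟨h1, h2, h3, h4⟩ F ⟨h1', h2', h3', h4'⟩
    refine ⟨h1.union h1' (hl.mono (Set.subset_inter h2 h2')), h2.trans Set.subset_union_left,
      Set.union_subset h3 h3', ?_⟩
    rw [Set.inter_union_distrib_left]
    exact h4.union h4'
  have hne : 𝒢.Nonempty := by
    obtain ⟨u, hu⟩ := hR.nonempty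
    obtain ⟨Y, h1, h2, h3, h4, h5⟩ := hY u hu
    exact ⟨Y, h1.toPre, h2, h3, h5⟩
  obtain ⟨hfin, E, hE, hEC⟩ := dir_key h hne (fun E hE F hF =>
    ⟨_, hunion E hE F hF, Set.subset_union_left, Set.subset_union_right⟩) (fun E hE => hE.1)
  have hsm : Small G ω (⋃₀ 𝒢) := hA.small.mono (Set.sUnion_subset fun E hE => hE.2.2.1)
  obtain ⟨u, hu, huE⟩ := (hR.sdiff hE.2.2.2).nonempty
  have huE : u ∉ E := fun h' => huE ⟨hu.1.1, h'⟩
  obtain ⟨Y, h1, h2, h3, h4, h5⟩ := hY u hu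
  have hEY := hunion E hE Y ⟨h1.toPre, h2, h3, h5⟩
  have hub := key_out hE.1 h1.toPre (hl.mono (Set.subset_inter hE.2.1 h2)) h4 huE
  have huC := key_C h hE.1 hEY.1 Set.subset_union_left hub huE
  exact Set.disjoint_left.1 (h.dich_small hsm hfin) (hEC huC) ⟨_, hEY, bd_sub hub⟩

theorem Q_sdiff (h : OE G ω) {P Y : Set V} (hl : Lk G ω κ P) (hY : Cut G ω κ Y) (hPY : P ⊆ Y) :
    Q G ω κ P \ Y = Q G ω κ Y \ Y := by
  refine Set.Subset.antisymm ?_ fun v hv => ⟨Q_anti hPY hv.1, hv.2⟩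
  rintro v ⟨⟨Z, hZ, hPZ, hv⟩, hvY⟩
  refine ⟨?_, hvY⟩
  have hl' := hl.mono (Set.subset_inter hPY hPZ)
  have hP := hY.toPre.union hZ.toPre hl'
  refine ⟨_, hP.fill h, Set.subset_union_left.trans (hP.sub_fill h), ?_⟩
  rw [hP.bd_fill h]
  exact key_out hY.toPre hZ.toPre hl' hv hvY

theorem lemmaM (h : OE G ω) {P Y : Set V} (hl : Lk G ω κ P) (hY : Cut G ω κ Y) (hPY : P ⊆ Y) :
    Small G ω (⋃₀ {A | Cut G ω κ A ∧ P ⊆ A ∧ ¬ Y ⊆ A}) := by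
  have key : ∀ y ∈ bd G Y, Small G ω (⋃₀ {A | Cut G ω κ A ∧ P ⊆ A ∧ y ∉ A}) := by
    intro y hy
    rcases Set.eq_empty_or_nonempty {A | Cut G ω κ A ∧ P ⊆ A ∧ y ∉ A} with he | hne
    · rw [he, Set.sUnion_empty]
      exact small_finite Set.finite_empty
    have hd : ∀ A ∈ {A | Cut G ω κ A ∧ P ⊆ A ∧ y ∉ A}, ∀ B ∈ {A | Cut G ω κ A ∧ P ⊆ A ∧ y ∉ A},
        ∃ D ∈ {A | Cut G ω κ A ∧ P ⊆ A ∧ y ∉ A}, A ⊆ D ∧ B ⊆ D := by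
      rintro A ⟨hA, hPA, hyA⟩ B ⟨hB, hPB, hyB⟩
      have hP := hA.toPre.union hB.toPre (hl.mono (Set.subset_inter hPA hPB))
      have hPU : P ⊆ A ∪ B := hPA.trans Set.subset_union_left
      have hyAB : y ∉ A ∪ B := by rintro (h' | h'); exacts [hyA h', hyB h']
      have hl' := hl.mono (Set.subset_inter hPU hPY)
      have hyb := key_out hP hY.toPre hl' hy hyAB
      have hyC := key_C h hP (hP.union hY.toPre hl') Set.subset_union_left hyb hyAB
      refine ⟨_, ⟨hP.fill h, hPU.trans (hP.sub_fill h), fun h' => h' hyC⟩,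
        Set.subset_union_left.trans (hP.sub_fill h), Set.subset_union_right.trans (hP.sub_fill h)⟩
    obtain ⟨hfin, E, hE, hEC⟩ := dir_key h hne hd (fun E hE => hE.1.toPre)
    refine ⟨_, hfin, (h.dich _).resolve_left fun hsub => ?_⟩
    obtain ⟨A, hA, hyA⟩ := hsub (hEC (hE.1.co hE.2.2))
    exact hA.2.2 hyA
  refine (small_biUnion hY.fin key).mono ?_
  rintro v ⟨A, ⟨hA, hPA, hYA⟩, hv⟩
  obtain ⟨y, hy, hyA⟩ : ∃ y ∈ bd G Y, y ∉ A := by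
    by_contra hcon
    push Not at hcon
    exact hYA (hY.sub_of_bd h hA hcon)
  exact Set.mem_iUnion₂.2 ⟨y, hy, A, ⟨hA, hPA, hyA⟩, hv⟩

/-- The rank of a cut. -/
noncomputable def rk {V : Type} (G : SimpleGraph V) (ω : ℕ → V) (κ : ℕ) (P A : Set V) : ℕ :=
  (Q G ω κ P ∩ A).ncard

theorem rk_mono (h : OE G ω) {P A A' : Set V} (hl : Lk G ω κ P) (hPA : P ⊆ A)
    (hA' : Cut G ω κ A') (hs : A ⊆ A') : rk G ω κ P A ≤ rk G ω κ P A' :=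
  Set.ncard_le_ncard (Set.inter_subset_inter_right _ hs) (Q_fin h hl hA' (hPA.trans hs))

theorem rk_strict (h : OE G ω) {P A A' : Set V} (hl : Lk G ω κ P) (hA : Cut G ω κ A) (hPA : P ⊆ A)
    (hA' : Cut G ω κ A') (hs : A ⊂ A') : rk G ω κ P A < rk G ω κ P A' := by
  refine Set.ncard_lt_ncard ⟨Set.inter_subset_inter_right _ hs.1, fun hcon => ?_⟩
    (Q_fin h hl hA' (hPA.trans hs.1))
  refine hs.2 (hA'.sub_of_bd h hA fun v hv => ?_)
  exact (hcon ⟨⟨A', hA', hPA.trans hs.1, hv⟩, bd_sub hv⟩).2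

theorem rk_smul (h : OE G ω) (g : G ≃g G) (P A : Set V) :
    rk G ω κ (g • P) (g • A) = rk G ω κ P A := by
  rw [rk, rk, ← Q_smul h, ← Set.smul_set_inter]
  exact Set.ncard_image_of_injective _ (MulAction.injective g)

theorem rk_diff (h : OE G ω) {P Y A : Set V} (hl : Lk G ω κ P) (hY : Cut G ω κ Y) (hPY : P ⊆ Y)
    (hA : Cut G ω κ A) (hYA : Y ⊆ A) :
    rk G ω κ P A = rk G ω κ P Y + ((Q G ω κ Y \ Y) ∩ A).ncard := by
  have hf := Q_fin h hl hA (hPY.trans hYA)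
  rw [← Q_sdiff h hl hY hPY, rk, rk, ← Set.ncard_union_eq ?_ (Q_fin h hl hY hPY) ?_]
  · congr 1
    ext v
    constructor
    · rintro ⟨h1, h2⟩
      by_cases hv : v ∈ Y
      · exact Or.inl ⟨h1, hv⟩
      · exact Or.inr ⟨⟨h1, hv⟩, h2⟩
    · rintro (⟨h1, h2⟩ | ⟨⟨h1, _⟩, h2⟩)
      · exact ⟨h1, hYA h2⟩
      · exact ⟨h1, h2⟩
  · rw [Set.disjoint_left]
    exact fun v hv hv' => hv'.1.2 hv.2
  · exact hf.subset fun v hv => ⟨hv.1.1, hv.2⟩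

theorem Ctx.rk_inv (c : Ctx G ω κ Z₀) (g : G ≃g G) {P Y A : Set V} (hl : Lk G ω κ P)
    (hY : Cut G ω κ Y) (hPY : P ⊆ Y) (hPY' : g⁻¹ • P ⊆ Y) (hA : Cut G ω κ A) (hYA : Y ⊆ A) :
    rk G ω κ P (g • A) = rk G ω κ P A := by
  have hg : ∀ A, rk G ω κ P (g • A) = rk G ω κ (g⁻¹ • P) A := by
    intro A
    have := rk_smul c.oe (κ := κ) g (g⁻¹ • P) A
    rwa [smul_inv_smul] at this
  obtain ⟨W, hW, hYW, hfix⟩ := c.step4 g hY.small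
  have hl' := hl.smul c.oe g⁻¹
  have h1 := rk_diff c.oe hl hY hPY hW hYW
  have h2 := rk_diff c.oe hl' hY hPY' hW hYW
  have h3 := rk_diff c.oe hl hY hPY hA hYA
  have h4 := rk_diff c.oe hl' hY hPY' hA hYA
  have h5 := hg W
  rw [hfix] at h5
  rw [hg]
  omega

theorem Ctx.exists_bigger (c : Ctx G ω κ Z₀) {B : Set V} (hB : Small G ω B) :
    ∃ A, Cut G ω κ A ∧ B ⊂ A := by
  obtain ⟨A, hA, hBA⟩ := c.exists_cut hB
  obtain ⟨v, hv⟩ := c.oe.C_nonempty hA.fin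
  have hvA : v ∉ A := Set.disjoint_left.1 (hA.disj c.oe) hv
  obtain ⟨A', hA', hs⟩ := c.exists_cut (hB.union (small_finite (Set.finite_singleton v)))
  exact ⟨A', hA', Set.subset_union_left.trans hs, fun h' => hvA (hBA (h' (hs (Or.inr rfl))))⟩

theorem Ctx.step5 (c : Ctx G ω κ Z₀) {S : Set (G ≃g G)} (hS : S.Finite) {B : Set V}
    (hB : Small G ω B) : ∃ W, Cut G ω κ W ∧ B ⊆ W ∧ ∀ s ∈ S, s • W = W := by
  have hl := c.lk
  have hZs : Small G ω Z₀ := small_finite c.fin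
  obtain ⟨Y, hY, hYs⟩ := c.exists_cut ((hB.union hZs).union
    (small_biUnion hS (A := fun s => s⁻¹ • Z₀) fun s _ => c.oe.small_smul s⁻¹ hZs))
  have hBY : B ⊆ Y := (Set.subset_union_left.trans Set.subset_union_left).trans hYs
  have hPY : Z₀ ⊆ Y := (Set.subset_union_right.trans Set.subset_union_left).trans hYs
  have hsY : ∀ s ∈ S, s⁻¹ • Z₀ ⊆ Y := fun s hs v hv =>
    hYs (Or.inr (Set.mem_iUnion₂.2 ⟨s, hs, hv⟩))
  obtain ⟨D, hD, hDs⟩ := c.exists_cut ((lemmaM c.oe hl hY hPY).union hY.small)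
  obtain ⟨A₀, hA₀, hDA⟩ := c.exists_bigger hD.small
  obtain ⟨Y', hY', hAY'⟩ := c.exists_bigger hA₀.small
  have hYD : Y ⊆ D := Set.subset_union_right.trans hDs
  have hZD : Z₀ ⊆ D := hPY.trans hYD
  have hlt1 := rk_strict c.oe hl hD hZD hA₀ hDA
  have hZA : Z₀ ⊆ A₀ := hZD.trans hDA.1
  have hlt2 := rk_strict c.oe hl hA₀ hZA hY' hAY'
  let 𝒳 : Set (Set V) := {A | Cut G ω κ A ∧ Z₀ ⊆ A ∧ rk G ω κ Z₀ A = rk G ω κ Z₀ A₀}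
  have h1 : ∀ A ∈ 𝒳, Y ⊆ A := by
    rintro A ⟨hA, hZ, hr⟩
    by_contra hYA
    have : A ⊆ D := (Set.subset_sUnion_of_mem (S := {A | Cut G ω κ A ∧ Z₀ ⊆ A ∧ ¬ Y ⊆ A})
      ⟨hA, hZ, hYA⟩).trans (Set.subset_union_left.trans hDs)
    have := rk_mono c.oe hl hZ hD this
    omega
  have hA₀X : A₀ ∈ 𝒳 := ⟨hA₀, hZA, rfl⟩
  have hNs : Small G ω (⋃₀ 𝒳) := by
    refine (lemmaM c.oe hl hY' (hZA.trans hAY'.1)).mono (Set.sUnion_mono ?_)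
    rintro A ⟨hA, hZ, hr⟩
    refine ⟨hA, hZ, fun hYA => ?_⟩
    have := rk_mono c.oe hl (hZA.trans hAY'.1) hA hYA
    omega
  have hsub : A₀ ⊆ ⋃₀ 𝒳 := Set.subset_sUnion_of_mem hA₀X
  obtain ⟨W, hW, hNW, hfix⟩ := c.fix_of_small hNs (hA₀.lk.mono hsub) (S := S) (by
    rintro s hs _ ⟨v, ⟨A, hA, hv⟩, rfl⟩
    refine ⟨s • A, ⟨hA.1.smul c.oe s, ?_, ?_⟩, Set.smul_mem_smul_set hv⟩
    · rw [Set.subset_smul_set_iff]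
      exact (hsY s hs).trans (h1 A hA)
    · rw [c.rk_inv s hl hY hPY (hsY s hs) hA.1 (h1 A hA)]
      exact hA.2.2)
  exact ⟨W, hW, (hBY.trans (h1 A₀ hA₀X)).trans (hsub.trans hNW), hfix⟩

end Fixing


section Final
open scoped Pointwise
variable {V : Type} {G : SimpleGraph V} {ω : ℕ → V} {κ : ℕ} {Z₀ : Set V}

theorem Cut.restr (h : OE G ω) {A : Set V} (hA : Cut G ω κ A) {g : G ≃g G} (hg : g • A = A)
    (hX : ∀ x ∈ bd G A, g • x = x) : ∃ f : FF h, ∀ v ∈ A, (f : G ≃g G) • v = g • v := by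
  have hb : g • bd G A = bd G A := by rw [← bd_smul, hg]
  obtain ⟨f, hf1, hf2⟩ := restrict_lemma (O := A \ bd G A) (h := g)
    (by rw [Set.smul_set_sdiff, hg, hb]) (by
      intro u hu v hv huv
      have hvA : v ∈ A := by
        by_contra hvA
        exact hu.2 ⟨hu.1, v, hvA, huv⟩
      refine hX v ?_
      by_contra hvb
      exact hv ⟨hvA, hvb⟩)
  refine ⟨⟨f, (mem_FF h).2 (hA.small.mono fun v hv => ?_)⟩, fun v hv => ?_⟩
  · by_contra hvA
    exact hv (hf2 v fun h' => hvA h'.1)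
  · by_cases hvb : v ∈ bd G A
    · change f • v = g • v
      rw [hX v hvb]
      exact hf2 v fun h' => h'.2 hvb
    · exact hf1 v ⟨hv, hvb⟩

theorem Ctx.card_le (c : Ctx G ω κ Z₀) [Finite (FF c.oe)] (S : Finset (G ≃g G)) :
    S.card ≤ Nat.card (FF c.oe) * κ ^ κ := by
  classical
  have hsep : ∀ p : (G ≃g G) × (G ≃g G), ∃ v : V, p.1 ≠ p.2 → p.1 • v ≠ p.2 • v := by
    intro p
    by_contra hcon
    push Not at hcon
    by_cases hp : p.1 = p.2
    · exact (hcon (p.1.symm (ω 0))).1 hp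
    · exact hp (aut_ext fun v => (hcon v).2)
  choose z hz using hsep
  obtain ⟨A, hA, hZA, hfix⟩ := c.step5 S.finite_toSet
    (small_finite (G := G) (ω := ω) ((S.finite_toSet.prod S.finite_toSet).image z))
  have hbfix : ∀ s ∈ S, s • bd G A = bd G A := fun s hs => by rw [← bd_smul, hfix s hs]
  have hXf : Finite (bd G A) := hA.fin
  have := Fintype.ofFinite (bd G A)
  have hcard : Fintype.card (bd G A) = κ := by
    have := hA.eq
    rw [← Nat.card_eq_fintype_card, Nat.card_coe_set_eq, Set.ncard, this]
    rfl
  let φ : (G ≃g G) → (bd G A → bd G A) := fun s x =>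
    if hs : s ∈ S then ⟨s • (x : V), (hbfix s hs).subset (Set.smul_mem_smul_set x.2)⟩ else x
  have hle := Finset.card_le_mul_card_image_of_maps_to (s := S) (t := Finset.univ) (f := φ)
    (fun _ _ => Finset.mem_univ _) (Nat.card (FF c.oe)) (by
      intro b _
      rcases (S.filter fun a => φ a = b).eq_empty_or_nonempty with he | ⟨s₀, hs₀⟩
      · rw [he]; simp
      rw [Finset.mem_filter] at hs₀
      have hr : ∀ s : {s // s ∈ S.filter fun a => φ a = b}, ∃ f : FF c.oe, ∀ v ∈ A,
          (f : G ≃g G) • v = (s₀⁻¹ * s.1) • v := by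
        rintro ⟨s, hs⟩
        rw [Finset.mem_filter] at hs
        refine hA.restr c.oe ?_ ?_
        · rw [mul_smul, hfix s hs.1, inv_smul_eq_iff, hfix s₀ hs₀.1]
        · intro x hx
          rw [mul_smul, inv_smul_eq_iff]
          have := congrArg Subtype.val (congrFun (hs.2.trans hs₀.2.symm) ⟨x, hx⟩)
          simp only [φ, dif_pos hs.1, dif_pos hs₀.1] at this
          exact this
      choose F hF using hr
      have hinj : Function.Injective F := by
        rintro ⟨s, hs⟩ ⟨t, ht⟩ hst
        rw [Subtype.mk.injEq]
        by_contra hne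
        have hs' := (Finset.mem_filter.1 hs).1
        have ht' := (Finset.mem_filter.1 ht).1
        have hzA : z (s, t) ∈ A := hZA ⟨(s, t), ⟨hs', ht'⟩, rfl⟩
        have h1 := hF ⟨s, hs⟩ _ hzA
        have h2 := hF ⟨t, ht⟩ _ hzA
        rw [hst, h2, mul_smul, mul_smul] at h1
        exact hz (s, t) hne (smul_left_cancel _ h1).symm
      have := Nat.card_le_card_of_injective F hinj
      rwa [Nat.card_eq_fintype_card, Fintype.card_coe] at this)
  have hcu : (Finset.univ : Finset (bd G A → bd G A)).card = κ ^ κ := by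
    rw [Finset.card_univ, Fintype.card_fun, hcard]
  rwa [hcu] at hle

theorem OE.main (h : OE G ω) (hb : ∃ κ, Bdd G ω κ) :
    Finite (G ≃g G) ∨ Cardinal.continuum ≤ Cardinal.mk (G ≃g G) := by
  by_contra hcon
  push Not at hcon
  obtain ⟨hinf, hlt⟩ := hcon
  obtain ⟨κ, Z₀, c⟩ := h.exists_ctx hb
  have : Finite (FF c.oe) := c.oe.FF_finite (not_le.2 hlt)
  have : Infinite (G ≃g G) := hinf
  obtain ⟨S, hS⟩ := Infinite.exists_subset_card_eq (G ≃g G) (Nat.card (FF c.oe) * κ ^ κ + 1)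
  have := c.card_le S
  omega

end Final

/-- a graph with exactly one end of finite vertex degree has an
automorphism group that is finite or of cardinality at least `2^ℵ₀`. -/
theorem automorphism_group_dichotomy {V : Type} (G : SimpleGraph V) (ω : ℕ → V) (k : ℕ)
    (hray : IsRay G ω) (hone : ∀ r, IsRay G r → RayEquiv G r ω)
    (hdeg : EndVertexDegree G ω k) :
    Finite (G ≃g G) ∨ Cardinal.continuum ≤ Cardinal.mk (G ≃g G) := by
  have h : OE G ω := ⟨hray, hone⟩
  exact h.main (h.exists_bdd hdeg.2)

end PaperEnds
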